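/- There exist η > 0 and μ₀ > 0 such that for every μ ∈ (0, μ₀) and every energy h ∈ (−ημ, ημ) there is a sequence of solutions (q_k(t), p_k(t)), k ∈ ℕ, of the planar circular restricted three-body problem with mass ratio μ, each defined on an open bounded interval (a_k, b_k), such that: (i) H(q_k(t), p_k(t); μ) = h for all t ∈ (a_k, b_k); (ii) each orbit is an ejection–collision orbit with the first primary, i.e. lim_{t→a_k⁺} q_k(t) = (−μ, 0) and lim_{t→b_k⁻} q_k(t) = (−μ, 0); and (iii) limsup_{k→∞} ( sup_{t∈(a_k,b_k)} ‖q_k(t)‖ ) = +∞. -/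

import Mathlib

open Real Filter MeasureTheory
open scoped Topology

/-- Euclidean norm of a planar vector given by its components. -/
noncomputable def nrm2 (x y : ℝ) : ℝ := Real.sqrt (x ^ 2 + y ^ 2)

/-- Distance from `(x,y)` to the first (massive) primary, located at `(-μ,0)`. -/
noncomputable def dS (μ x y : ℝ) : ℝ := Real.sqrt ((x + μ) ^ 2 + y ^ 2)

/-- Distance from `(x,y)` to the second primary, located at `(1-μ,0)`. -/
noncomputable def dJ (μ x y : ℝ) : ℝ := Real.sqrt ((x - (1 - μ)) ^ 2 + y ^ 2)

/-- `(q₁,q₂,p₁,p₂)` is a solution of the planar circular restricted three-body problem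
with mass ratio `μ` on the set `I` of times: it avoids the two singularities and satisfies
Hamilton's equations `q̇ = ∂H/∂p`, `ṗ = -∂H/∂q` for the Hamiltonian
`H(q,p;μ) = ‖p‖²/2 - q₁p₂ + q₂p₁ - (1-μ)/‖q+(μ,0)‖ - μ/‖q-(1-μ,0)‖`,
whose partial derivatives have been computed explicitly. -/
def IsPCRTBPSol (μ : ℝ) (I : Set ℝ) (q1 q2 p1 p2 : ℝ → ℝ) : Prop :=
  ∀ t ∈ I,
    ((q1 t, q2 t) ≠ (-μ, 0) ∧ (q1 t, q2 t) ≠ (1 - μ, 0)) ∧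
    HasDerivAt q1 (p1 t + q2 t) t ∧
    HasDerivAt q2 (p2 t - q1 t) t ∧
    HasDerivAt p1 (p2 t - (1 - μ) * (q1 t + μ) / (dS μ (q1 t) (q2 t)) ^ 3
        - μ * (q1 t - (1 - μ)) / (dJ μ (q1 t) (q2 t)) ^ 3) t ∧
    HasDerivAt p2 (-(p1 t) - (1 - μ) * (q2 t) / (dS μ (q1 t) (q2 t)) ^ 3
        - μ * (q2 t) / (dJ μ (q1 t) (q2 t)) ^ 3) t


/-- The Hamiltonian of the PCRTBP in rotating Cartesian coordinates. -/
noncomputable def Ham (μ q1 q2 p1 p2 : ℝ) : ℝ :=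
  (p1 ^ 2 + p2 ^ 2) / 2 - q1 * p2 + q2 * p1 - (1 - μ) / dS μ q1 q2 - μ / dJ μ q1 q2

open scoped NNReal in
/-- A bounded Lipschitz vector field on a Banach space has a globally defined flow. -/
theorem exists_global_flow {E : Type*} [NormedAddCommGroup E] [NormedSpace ℝ E] [CompleteSpace E]
    {f : E → E} {K L : ℝ≥0} (hK : LipschitzWith K f) (hL : ∀ x, ‖f x‖ ≤ L) :
    ∃ Φ : E → ℝ → E, (∀ x, Φ x 0 = x) ∧ ∀ x t, HasDerivAt (Φ x) (f (Φ x t)) t := by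
  have key : ∀ (x : E) (n : ℕ), ∃ γ : ℝ → E, γ 0 = x ∧
      ∀ t ∈ Set.Ioo (-(n + 1 : ℝ)) (n + 1), HasDerivAt γ (f (γ t)) t := by
    intro x n
    have hn : (0 : ℝ) < n + 1 := by positivity
    have h0 : (0 : ℝ) ∈ Set.Icc (-(n + 1 : ℝ)) (n + 1) := ⟨by linarith, hn.le⟩
    have hP : IsPicardLindelof (fun _ => f) (⟨0, h0⟩ : Set.Icc (-(n + 1 : ℝ)) (n + 1)) x
        (L * (n + 1)) 0 L K :=
      { lipschitzOnWith := fun _ _ => hK.lipschitzOnWith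
        continuousOn := fun _ _ => continuousOn_const
        norm_le := fun _ _ y _ => hL y
        mul_max_le := by simp }
    obtain ⟨γ, hγ0, hγ⟩ := hP.exists_eq_forall_mem_Icc_hasDerivWithinAt₀
    exact ⟨γ, hγ0, fun t ht => (hγ t ⟨ht.1.le, ht.2.le⟩).hasDerivAt (Icc_mem_nhds ht.1 ht.2)⟩
  choose γ hγ0 hγ using key
  have uniq : ∀ (x : E) (n m : ℕ), n ≤ m → ∀ t ∈ Set.Ioo (-(n + 1 : ℝ)) (n + 1),
      γ x n t = γ x m t := by
    intro x n m hnm t ht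
    have hn : (0 : ℝ) < n + 1 := by positivity
    have hnm' : (n : ℝ) ≤ m := by exact_mod_cast hnm
    exact ODE_solution_unique_of_mem_Ioo (v := fun _ => f) (s := fun _ => Set.univ) (K := K)
      (fun _ _ => hK.lipschitzOnWith) (t₀ := 0) ⟨by linarith, hn⟩
      (fun t ht => ⟨hγ x n t ht, trivial⟩)
      (fun t ht => ⟨hγ x m t ⟨by linarith [ht.1], by linarith [ht.2]⟩, trivial⟩)
      (by rw [hγ0, hγ0]) ht
  refine ⟨fun x t => γ x ⌈|t|⌉₊ t, fun x => hγ0 x _, fun x t => ?_⟩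
  set N : ℕ := ⌈|t|⌉₊ + 1 with hN
  have hmem : ∀ s : ℝ, s ∈ Set.Ioo (-(⌈|s|⌉₊ + 1 : ℝ)) (⌈|s|⌉₊ + 1) := fun s =>
    abs_lt.mp (lt_of_le_of_lt (Nat.le_ceil |s|) (by linarith))
  have htN : |t| < N := by
    rw [hN]; push_cast
    linarith [Nat.le_ceil |t|]
  have heq : ∀ s : ℝ, |s| < N → γ x ⌈|s|⌉₊ s = γ x N s := fun s hs =>
    uniq x _ N (Nat.ceil_le.mpr hs.le) s (hmem s)
  have hev : (fun s => γ x ⌈|s|⌉₊ s) =ᶠ[𝓝 t] γ x N := by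
    filter_upwards [(isOpen_lt continuous_abs continuous_const).mem_nhds htN] with s hs
      using heq s hs
  have hd := (hγ x N t (abs_lt.mp (by linarith))).congr_of_eventuallyEq hev
  rwa [← heq t htN] at hd

open scoped NNReal in
theorem dist_flow_le {E : Type*} [NormedAddCommGroup E] [NormedSpace ℝ E]
    {f : E → E} {K : ℝ≥0} (hK : LipschitzWith K f) {γ₁ γ₂ : ℝ → E} {T : ℝ}
    (h₁ : ∀ t ∈ Set.Icc 0 T, HasDerivAt γ₁ (f (γ₁ t)) t)
    (h₂ : ∀ t ∈ Set.Icc 0 T, HasDerivAt γ₂ (f (γ₂ t)) t) :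
    ∀ t ∈ Set.Icc 0 T, dist (γ₁ t) (γ₂ t) ≤ dist (γ₁ 0) (γ₂ 0) * exp (K * t) := by
  intro t ht
  have := dist_le_of_trajectories_ODE (v := fun _ => f) (fun _ => hK)
    (fun t ht => (h₁ t ht).continuousAt.continuousWithinAt)
    (fun t ht => (h₁ t ⟨ht.1, ht.2.le⟩).hasDerivWithinAt)
    (fun t ht => (h₂ t ht).continuousAt.continuousWithinAt)
    (fun t ht => (h₂ t ⟨ht.1, ht.2.le⟩).hasDerivWithinAt) le_rfl t ht
  simpa using this

/-- Bounded and Lipschitz real-valued functions. -/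
def BddLip {E : Type*} [PseudoMetricSpace E] (φ : E → ℝ) : Prop :=
  ∃ C : ℝ, 0 ≤ C ∧ (∀ x, |φ x| ≤ C) ∧ ∀ x y, |φ x - φ y| ≤ C * dist x y

namespace BddLip

variable {E : Type*} [PseudoMetricSpace E] {φ ψ : E → ℝ}

theorem const (c : ℝ) : BddLip fun _ : E => c :=
  ⟨|c|, abs_nonneg c, fun _ => le_rfl, fun x y => by simpa using by positivity⟩

theorem add (hφ : BddLip φ) (hψ : BddLip ψ) : BddLip fun x => φ x + ψ x := by
  obtain ⟨C, hC, h1, h2⟩ := hφ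
  obtain ⟨D, hD, h3, h4⟩ := hψ
  refine ⟨C + D, by positivity, fun x => (abs_add_le _ _).trans (add_le_add (h1 x) (h3 x)),
    fun x y => ?_⟩
  calc |φ x + ψ x - (φ y + ψ y)| = |(φ x - φ y) + (ψ x - ψ y)| := by ring_nf
    _ ≤ _ := (abs_add_le _ _).trans (by linarith [h2 x y, h4 x y])

theorem mul (hφ : BddLip φ) (hψ : BddLip ψ) : BddLip fun x => φ x * ψ x := by
  obtain ⟨C, hC, h1, h2⟩ := hφ
  obtain ⟨D, hD, h3, h4⟩ := hψ
  refine ⟨2 * (C * D), by positivity, fun x => ?_, fun x y => ?_⟩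
  · rw [abs_mul]
    have := mul_le_mul (h1 x) (h3 x) (abs_nonneg _) hC
    nlinarith [mul_nonneg hC hD]
  · calc |φ x * ψ x - φ y * ψ y| = |φ x * (ψ x - ψ y) + (φ x - φ y) * ψ y| := by ring_nf
      _ ≤ |φ x| * |ψ x - ψ y| + |φ x - φ y| * |ψ y| := by
        rw [← abs_mul, ← abs_mul]; exact abs_add_le _ _
      _ ≤ C * (D * dist x y) + (C * dist x y) * D := by
        gcongr
        · exact h1 x
        · exact h4 x y
        · exact h2 x y
        · exact h3 y
      _ = _ := by ring

theorem neg (hφ : BddLip φ) : BddLip fun x => -φ x := by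
  simpa using (const (-1)).mul hφ

theorem sub (hφ : BddLip φ) (hψ : BddLip ψ) : BddLip fun x => φ x - ψ x := by
  simpa [sub_eq_add_neg] using hφ.add hψ.neg

theorem pow (hφ : BddLip φ) (n : ℕ) : BddLip fun x => φ x ^ n := by
  induction n with
  | zero => simpa using const 1
  | succ n ih => simpa [pow_succ] using ih.mul hφ

theorem div_const (hφ : BddLip φ) (c : ℝ) : BddLip fun x => φ x / c := by
  simpa [div_eq_mul_inv] using hφ.mul (const c⁻¹)

/-- The inverse of a Lipschitz function bounded away from zero. -/
theorem inv_of_le {C ε : ℝ} (hε : 0 < ε) (h : ∀ x y, |φ x - φ y| ≤ C * dist x y)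
    (hpos : ∀ x, ε ≤ φ x) : BddLip fun x => (φ x)⁻¹ := by
  have hb : ∀ x, |(φ x)⁻¹| ≤ ε⁻¹ := fun x => by
    rw [abs_of_pos (inv_pos.mpr (hε.trans_le (hpos x)))]
    exact inv_anti₀ hε (hpos x)
  refine ⟨max ε⁻¹ (|C| * ε⁻¹ * ε⁻¹), by positivity, fun x => (hb x).trans (le_max_left _ _),
    fun x y => ?_⟩
  have hx := hε.trans_le (hpos x)
  have hy := hε.trans_le (hpos y)
  calc |(φ x)⁻¹ - (φ y)⁻¹| = |φ x - φ y| * (|(φ x)⁻¹| * |(φ y)⁻¹|) := by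
        rw [← abs_mul, ← abs_mul, ← abs_neg]
        congr 1
        field_simp
        ring
    _ ≤ (|C| * dist x y) * (ε⁻¹ * ε⁻¹) := by
        gcongr
        · exact (h x y).trans (by gcongr; exact le_abs_self C)
        · exact hb x
        · exact hb y
    _ = (|C| * ε⁻¹ * ε⁻¹) * dist x y := by ring
    _ ≤ _ := by gcongr; exact le_max_right _ _

theorem inv (hφ : BddLip φ) {ε : ℝ} (hε : 0 < ε) (hpos : ∀ x, ε ≤ φ x) :
    BddLip fun x => (φ x)⁻¹ := by
  obtain ⟨C, _, _, h⟩ := hφ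
  exact inv_of_le hε h hpos

theorem sqrt (hφ : BddLip φ) {ε : ℝ} (hε : 0 < ε) (hpos : ∀ x, ε ≤ φ x) :
    BddLip fun x => √(φ x) := by
  obtain ⟨C, hC, h1, h2⟩ := hφ
  have hs : 0 < √ε := Real.sqrt_pos.mpr hε
  have hge : ∀ x, √ε ≤ √(φ x) := fun x => Real.sqrt_le_sqrt (hpos x)
  refine ⟨max (√C) (C / √ε), by positivity, fun x => ?_, fun x y => ?_⟩
  · rw [abs_of_nonneg (Real.sqrt_nonneg _)]
    exact (Real.sqrt_le_sqrt ((le_abs_self _).trans (h1 x))).trans (le_max_left _ _)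
  · have e : (√(φ x) - √(φ y)) * (√(φ x) + √(φ y)) = φ x - φ y := by
      ring_nf
      rw [Real.sq_sqrt (hε.le.trans (hpos x)), Real.sq_sqrt (hε.le.trans (hpos y))]
    have : |√(φ x) - √(φ y)| * √ε ≤ C * dist x y := by
      refine le_trans ?_ (h2 x y)
      rw [← e, abs_mul]
      gcongr
      rw [abs_of_nonneg (by positivity)]
      linarith [hge x, Real.sqrt_nonneg (φ y)]
    calc |√(φ x) - √(φ y)| ≤ C * dist x y / √ε := (le_div_iff₀ hs).mpr this
      _ = C / √ε * dist x y := by ring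
      _ ≤ _ := by gcongr; exact le_max_right _ _

theorem max_const (hφ : BddLip φ) (c : ℝ) : BddLip fun x => max (φ x) c := by
  obtain ⟨C, hC, h1, h2⟩ := hφ
  refine ⟨max C |c|, by positivity, fun x => ?_, fun x y => ?_⟩
  · exact (abs_max_le_max_abs_abs).trans (max_le_max (h1 x) le_rfl)
  · exact (abs_max_sub_max_le_abs _ _ _).trans ((h2 x y).trans (by gcongr; exact le_max_left _ _))

end BddLip

/-- Truncation of a real number to `[-N, N]`. -/
noncomputable def clampTo (N x : ℝ) : ℝ := max (-N) (min N x)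

theorem clampTo_eq {N x : ℝ} (h : |x| ≤ N) : clampTo N x = x := by
  rw [abs_le] at h
  rw [clampTo, min_eq_right h.2, max_eq_right h.1]

theorem abs_clampTo_le {N : ℝ} (hN : 0 ≤ N) (x : ℝ) : |clampTo N x| ≤ N :=
  abs_le.mpr ⟨le_max_left _ _, max_le (by linarith) (min_le_left _ _)⟩

theorem abs_clampTo_sub_le (N x y : ℝ) : |clampTo N x - clampTo N y| ≤ |x - y| := by
  unfold clampTo
  rw [max_comm (-N), max_comm (-N), min_comm N, min_comm N]
  exact (abs_max_sub_max_le_abs _ _ _).trans ((abs_min_sub_min_le_max _ _ _ _).trans (by simp))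

theorem BddLip.clamp_coord {ι : Type*} [Fintype ι] {N : ℝ} (hN : 0 ≤ N) (i : ι) :
    BddLip fun x : ι → ℝ => clampTo N (x i) := by
  refine ⟨max N 1, by positivity, fun x => (abs_clampTo_le hN _).trans (le_max_left _ _),
    fun x y => (abs_clampTo_sub_le N _ _).trans ?_⟩
  calc |x i - y i| = dist (x i) (y i) := (Real.dist_eq _ _).symm
    _ ≤ 1 * dist x y := by rw [one_mul]; exact dist_le_pi_dist x y i
    _ ≤ _ := by gcongr; exact le_max_right _ _

theorem BddLip.sin_coord {ι : Type*} [Fintype ι] (i : ι) :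
    BddLip fun x : ι → ℝ => Real.sin (x i) := by
  refine ⟨1, by positivity, fun x => Real.abs_sin_le_one _, fun x y => ?_⟩
  rw [one_mul]
  exact (Real.dist_eq _ _ ▸ Real.lipschitzWith_sin.dist_le_mul _ _).trans
    (by simpa using dist_le_pi_dist x y i)

theorem BddLip.cos_coord {ι : Type*} [Fintype ι] (i : ι) :
    BddLip fun x : ι → ℝ => Real.cos (x i) := by
  refine ⟨1, by positivity, fun x => Real.abs_cos_le_one _, fun x y => ?_⟩
  rw [one_mul]
  exact (Real.dist_eq _ _ ▸ Real.lipschitzWith_cos.dist_le_mul _ _).trans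
    (by simpa using dist_le_pi_dist x y i)

theorem exists_flow_of_bddLip {ι : Type*} [Fintype ι] {f : (ι → ℝ) → ι → ℝ}
    (hf : ∀ i, BddLip fun x => f x i) :
    ∃ (Φ : (ι → ℝ) → ℝ → ι → ℝ) (K : NNReal), LipschitzWith K f ∧ (∀ x, Φ x 0 = x) ∧
      ∀ x t, HasDerivAt (Φ x) (f (Φ x t)) t := by
  choose C hC h1 h2 using hf
  have hle : ∀ i, C i ≤ ∑ j, C j := fun i =>
    Finset.single_le_sum (fun j _ => hC j) (Finset.mem_univ i)
  have hS : 0 ≤ ∑ j, C j := Finset.sum_nonneg fun j _ => hC j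
  have hK : LipschitzWith (⟨∑ j, C j, hS⟩ : NNReal) f := by
    refine LipschitzWith.of_dist_le_mul fun x y => (dist_pi_le_iff (by positivity)).mpr fun i => ?_
    rw [Real.dist_eq]
    exact (h2 i x y).trans (by gcongr; exact hle i)
  obtain ⟨Φ, h0, hΦ⟩ := exists_global_flow (L := ⟨∑ j, C j, hS⟩) hK fun x =>
    (pi_norm_le_iff_of_nonneg hS).mpr fun i => (Real.norm_eq_abs _).trans_le ((h1 i x).trans (hle i))
  exact ⟨Φ, _, hK, h0, hΦ⟩

theorem dS_pos {μ x y : ℝ} (h : (x, y) ≠ (-μ, 0)) : 0 < dS μ x y := by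
  refine Real.sqrt_pos.mpr (lt_of_le_of_ne (by positivity) fun h0 => h ?_)
  have h1 : x + μ = 0 := by nlinarith [sq_nonneg (x + μ), sq_nonneg y]
  have h2 : y = 0 := by nlinarith [sq_nonneg (x + μ), sq_nonneg y]
  rw [h2, eq_neg_of_add_eq_zero_left h1]

theorem dJ_pos {μ x y : ℝ} (h : (x, y) ≠ (1 - μ, 0)) : 0 < dJ μ x y := by
  refine Real.sqrt_pos.mpr (lt_of_le_of_ne (by positivity) fun h0 => h ?_)
  have h1 : x - (1 - μ) = 0 := by nlinarith [sq_nonneg (x - (1 - μ)), sq_nonneg y]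
  have h2 : y = 0 := by nlinarith [sq_nonneg (x - (1 - μ)), sq_nonneg y]
  rw [h2, sub_eq_zero.mp h1]

theorem HasDerivAt.inv_sqrt_sum {f g : ℝ → ℝ} {f' g' t : ℝ} (hf : HasDerivAt f f' t)
    (hg : HasDerivAt g g' t) (h : 0 < √(f t ^ 2 + g t ^ 2)) :
    HasDerivAt (fun s => (√(f s ^ 2 + g s ^ 2))⁻¹)
      (-(f t * f' + g t * g') / √(f t ^ 2 + g t ^ 2) ^ 3) t := by
  have h1 := (((hf.pow 2).add (hg.pow 2)).sqrt (Real.sqrt_pos.mp h).ne').inv h.ne'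
  refine h1.congr_deriv ?_
  simp only [Pi.add_apply, Pi.pow_apply]
  field_simp
  ring

/-- The Hamiltonian is a first integral. -/
theorem IsPCRTBPSol.hasDerivAt_ham {μ : ℝ} {I : Set ℝ} {q1 q2 p1 p2 : ℝ → ℝ}
    (hsol : IsPCRTBPSol μ I q1 q2 p1 p2) {t : ℝ} (ht : t ∈ I) :
    HasDerivAt (fun s => Ham μ (q1 s) (q2 s) (p1 s) (p2 s)) 0 t := by
  obtain ⟨⟨hS, hJ⟩, h1, h2, h3, h4⟩ := hsol t ht
  have hS' := dS_pos hS
  have hJ' := dJ_pos hJ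
  have hSd : HasDerivAt (fun s => (dS μ (q1 s) (q2 s))⁻¹)
      (-((q1 t + μ) * (p1 t + q2 t) + q2 t * (p2 t - q1 t)) / dS μ (q1 t) (q2 t) ^ 3) t :=
    (h1.add_const μ).inv_sqrt_sum h2 hS'
  have hJd : HasDerivAt (fun s => (dJ μ (q1 s) (q2 s))⁻¹)
      (-((q1 t - (1 - μ)) * (p1 t + q2 t) + q2 t * (p2 t - q1 t)) / dJ μ (q1 t) (q2 t) ^ 3) t :=
    (h1.sub_const (1 - μ)).inv_sqrt_sum h2 hJ'
  have key := ((((((h3.pow 2).add (h4.pow 2)).div_const 2).sub (h1.mul h4)).add (h2.mul h3)).sub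
    (hSd.const_mul (1 - μ))).sub (hJd.const_mul μ)
  refine (key.congr_deriv ?_).congr_of_eventuallyEq (Eventually.of_forall fun s => ?_)
  · field_simp
    ring
  · simp only [Ham, div_eq_mul_inv]
    rfl

theorem IsPCRTBPSol.ham_eq {μ : ℝ} {I : Set ℝ} (hI : Convex ℝ I) {q1 q2 p1 p2 : ℝ → ℝ}
    (hsol : IsPCRTBPSol μ I q1 q2 p1 p2) {s t : ℝ} (hs : s ∈ I) (ht : t ∈ I) :
    Ham μ (q1 s) (q2 s) (p1 s) (p2 s) = Ham μ (q1 t) (q2 t) (p1 t) (p2 t) := by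
  have := hI.norm_image_sub_le_of_norm_hasDerivWithin_le (C := 0)
    (fun u hu => (hsol.hasDerivAt_ham hu).hasDerivWithinAt) (fun u _ => by simp) ht hs
  simpa [sub_eq_zero] using this

theorem HasDerivAt.glue {f g : ℝ → ℝ} {d t₀ : ℝ} (hf : HasDerivAt f d t₀)
    (hg : HasDerivAt g d t₀) (h : f t₀ = g t₀) :
    HasDerivAt (fun t => if t ≤ t₀ then f t else g t) d t₀ := by
  have h1 : HasDerivWithinAt (fun t => if t ≤ t₀ then f t else g t) d (Set.Iic t₀) t₀ :=
    hf.hasDerivWithinAt.congr (fun t ht => if_pos ht) (if_pos le_rfl)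
  have h2 : HasDerivWithinAt (fun t => if t ≤ t₀ then f t else g t) d (Set.Ioi t₀) t₀ :=
    hg.hasDerivWithinAt.congr (fun t ht => if_neg (not_le.mpr ht)) (by rw [if_pos le_rfl, h])
  have := h1.union h2
  rwa [Set.Iic_union_Ioi, hasDerivWithinAt_univ] at this

theorem HasDerivAt.ite_of_lt {f g : ℝ → ℝ} {d t t₀ : ℝ} (hf : HasDerivAt f d t) (h : t < t₀) :
    HasDerivAt (fun t => if t ≤ t₀ then f t else g t) d t :=
  hf.congr_of_eventuallyEq <| by
    filter_upwards [Iio_mem_nhds h] with s hs using if_pos hs.le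

theorem HasDerivAt.ite_of_gt {f g : ℝ → ℝ} {d t t₀ : ℝ} (hg : HasDerivAt g d t) (h : t₀ < t) :
    HasDerivAt (fun t => if t ≤ t₀ then f t else g t) d t :=
  hg.congr_of_eventuallyEq <| by
    filter_upwards [Ioi_mem_nhds h] with s hs using if_neg (not_le.mpr hs)

/-- Concatenation of two solutions that agree at time `t₀`. -/
theorem IsPCRTBPSol.glue {μ t₀ : ℝ} {I J : Set ℝ} {q1 q2 p1 p2 q1' q2' p1' p2' : ℝ → ℝ}
    (h : IsPCRTBPSol μ I q1 q2 p1 p2) (h' : IsPCRTBPSol μ J q1' q2' p1' p2')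
    (hI : t₀ ∈ I) (hJ : t₀ ∈ J)
    (e1 : q1 t₀ = q1' t₀) (e2 : q2 t₀ = q2' t₀) (e3 : p1 t₀ = p1' t₀) (e4 : p2 t₀ = p2' t₀) :
    IsPCRTBPSol μ ((I ∩ Set.Iic t₀) ∪ (J ∩ Set.Ici t₀))
      (fun t => if t ≤ t₀ then q1 t else q1' t) (fun t => if t ≤ t₀ then q2 t else q2' t)
      (fun t => if t ≤ t₀ then p1 t else p1' t) (fun t => if t ≤ t₀ then p2 t else p2' t) := by
  intro t ht
  rcases lt_trichotomy t t₀ with hlt | rfl | hgt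
  · have htI : t ∈ I := by
      rcases ht with ht | ht
      · exact ht.1
      · exact absurd ht.2 (not_le.mpr hlt)
    obtain ⟨hne, h1, h2, h3, h4⟩ := h t htI
    simp only [if_pos hlt.le]
    exact ⟨hne, h1.ite_of_lt hlt, h2.ite_of_lt hlt, h3.ite_of_lt hlt, h4.ite_of_lt hlt⟩
  · obtain ⟨hne, h1, h2, h3, h4⟩ := h t hI
    obtain ⟨-, h1', h2', h3', h4'⟩ := h' t hJ
    rw [← e1, ← e2, ← e4] at h3'
    rw [← e1, ← e2, ← e3] at h4'
    rw [← e2, ← e3] at h1'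
    rw [← e1, ← e4] at h2'
    simp only [le_refl, if_true]
    exact ⟨hne, h1.glue h1' e1, h2.glue h2' e2, h3.glue h3' e3, h4.glue h4' e4⟩
  · have htJ : t ∈ J := by
      rcases ht with ht | ht
      · exact absurd ht.2 (not_le.mpr hgt)
      · exact ht.1
    obtain ⟨hne, h1, h2, h3, h4⟩ := h' t htJ
    simp only [if_neg (not_le.mpr hgt)]
    exact ⟨hne, h1.ite_of_gt hgt, h2.ite_of_gt hgt, h3.ite_of_gt hgt, h4.ite_of_gt hgt⟩

/-- Reversibility: reflection in the axis through the primaries combined with time reversal. -/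
theorem IsPCRTBPSol.reflect {μ T : ℝ} {I : Set ℝ} {q1 q2 p1 p2 : ℝ → ℝ}
    (h : IsPCRTBPSol μ I q1 q2 p1 p2) :
    IsPCRTBPSol μ ((fun t => 2 * T - t) ⁻¹' I) (fun t => q1 (2 * T - t))
      (fun t => -q2 (2 * T - t)) (fun t => -p1 (2 * T - t)) (fun t => p2 (2 * T - t)) := by
  intro t ht
  obtain ⟨⟨hS, hJ⟩, h1, h2, h3, h4⟩ := h _ ht
  have hd : HasDerivAt (fun t : ℝ => 2 * T - t) (-1) t := by
    simpa using (hasDerivAt_id t).const_sub (2 * T)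
  have eS : ∀ x y, dS μ x (-y) = dS μ x y := fun x y => by simp [dS]
  have eJ : ∀ x y, dJ μ x (-y) = dJ μ x y := fun x y => by simp [dJ]
  simp only [eS, eJ]
  refine ⟨⟨fun e => hS ?_, fun e => hJ ?_⟩, (h1.comp t hd).congr_deriv ?_,
    (h2.comp t hd).neg.congr_deriv ?_, (h3.comp t hd).neg.congr_deriv ?_,
    (h4.comp t hd).congr_deriv ?_⟩
  · simpa [Prod.ext_iff] using e
  · simpa [Prod.ext_iff] using e
  all_goals ring

/-- An ejection orbit meeting the symmetry axis perpendicularly continues to an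
ejection–collision orbit. -/
theorem exists_ejection_collision_of_perpendicular {μ h a T : ℝ} (haT : a < T)
    {q1 q2 p1 p2 : ℝ → ℝ} (hsol : IsPCRTBPSol μ (Set.Ioc a T) q1 q2 p1 p2)
    (hH : Ham μ (q1 T) (q2 T) (p1 T) (p2 T) = h)
    (hlim : Tendsto (fun t => (q1 t, q2 t)) (𝓝[>] a) (𝓝 (-μ, 0)))
    (hq : q2 T = 0) (hp : p1 T = 0) :
    ∃ (b : ℝ) (Q1 Q2 P1 P2 : ℝ → ℝ), a < b ∧ IsPCRTBPSol μ (Set.Ioo a b) Q1 Q2 P1 P2 ∧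
      (∀ t ∈ Set.Ioo a b, Ham μ (Q1 t) (Q2 t) (P1 t) (P2 t) = h) ∧
      Tendsto (fun t => (Q1 t, Q2 t)) (𝓝[>] a) (𝓝 (-μ, 0)) ∧
      Tendsto (fun t => (Q1 t, Q2 t)) (𝓝[<] b) (𝓝 (-μ, 0)) ∧
      ∃ t ∈ Set.Ioo a b, Q1 t = q1 T ∧ Q2 t = q2 T := by
  have hTT : 2 * T - T = T := by ring
  have hT : T ∈ Set.Ioc a T := ⟨haT, le_rfl⟩
  have hglue := hsol.glue (hsol.reflect (T := T)) hT (t₀ := T)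
    (show 2 * T - T ∈ Set.Ioc a T by rwa [hTT]) (by rw [hTT]) (by rw [hTT, hq, neg_zero])
    (by rw [hTT, hp, neg_zero]) (by rw [hTT])
  have hmem : T ∈ Set.Ioo a (2 * T - a) := ⟨haT, by linarith⟩
  have hsol' := fun t (ht : t ∈ Set.Ioo a (2 * T - a)) => hglue t (by
    rcases le_total t T with h | h
    · exact Or.inl ⟨⟨ht.1, h⟩, h⟩
    · exact Or.inr ⟨⟨by linarith [ht.2], by linarith⟩, h⟩)
  refine ⟨2 * T - a, _, _, _, _, by linarith, hsol', fun t ht => ?_, ?_, ?_, T, hmem, ?_⟩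
  · rw [IsPCRTBPSol.ham_eq (convex_Ioo _ _) hsol' ht hmem]
    simpa using hH
  · refine hlim.congr' ?_
    filter_upwards [mem_nhdsWithin_of_mem_nhds (Iio_mem_nhds haT)] with t ht
    simp [le_of_lt (Set.mem_Iio.mp ht)]
  · have h1 : Tendsto (fun t : ℝ => 2 * T - t) (𝓝[<] (2 * T - a)) (𝓝[>] a) := by
      refine tendsto_nhdsWithin_of_tendsto_nhds_of_eventually_within _ ?_ ?_
      · have : Tendsto (fun t : ℝ => 2 * T - t) (𝓝 (2 * T - a)) (𝓝 (2 * T - (2 * T - a))) :=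
          (continuous_const.sub continuous_id).tendsto _
        rw [sub_sub_cancel] at this
        exact this.mono_left nhdsWithin_le_nhds
      · filter_upwards [self_mem_nhdsWithin] with t ht
        have : t < 2 * T - a := ht
        exact Set.mem_Ioi.mpr (by linarith)
    have h2 := hlim.comp h1
    have h3 : Tendsto (fun z : ℝ × ℝ => (z.1, -z.2)) (𝓝 (-μ, 0)) (𝓝 (-μ, 0)) := by
      have : Continuous fun z : ℝ × ℝ => (z.1, -z.2) := by fun_prop
      simpa using this.tendsto (-μ, 0)
    refine (h3.comp h2).congr' ?_
    filter_upwards [mem_nhdsWithin_of_mem_nhds (Ioi_mem_nhds (show T < 2 * T - a by linarith))]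
      with t ht
    simp [not_le.mpr (Set.mem_Ioi.mp ht)]
  · simp

/-- Reciprocal distance to the barycentre, truncated at distance `2`. -/
noncomputable def farInv (Y : Fin 4 → ℝ) : ℝ := (max (Y 0) 2)⁻¹

/-- Inverse cube of the distance to the point at `-a` on the first axis, in units of `|q|`. -/
noncomputable def farKer (a : ℝ) (Y : Fin 4 → ℝ) : ℝ :=
  (√(1 + 2 * a * farInv Y * cos (Y 2) + a ^ 2 * farInv Y ^ 2))⁻¹ ^ 3

/-- The equations of motion in rotating barycentric polar coordinates
`(ρ, ρ', angle, angular momentum)`, truncated so as to be bounded and Lipschitz. -/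
noncomputable def farField (μ : ℝ) (Y : Fin 4 → ℝ) : Fin 4 → ℝ :=
  ![clampTo 1 (Y 1),
    clampTo (1 / 2) (Y 3) ^ 2 * farInv Y ^ 3 - farInv Y ^ 2 *
      ((1 - μ) * (1 + μ * farInv Y * cos (Y 2)) * farKer μ Y +
        μ * (1 + (-(1 - μ)) * farInv Y * cos (Y 2)) * farKer (-(1 - μ)) Y),
    clampTo (1 / 2) (Y 3) * farInv Y ^ 2 - 1,
    μ * (1 - μ) * farInv Y ^ 2 * sin (Y 2) * (farKer μ Y - farKer (-(1 - μ)) Y)]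

theorem farInv_pos (Y : Fin 4 → ℝ) : 0 < farInv Y :=
  inv_pos.mpr (lt_of_lt_of_le two_pos (le_max_right _ _))

theorem farInv_le (Y : Fin 4 → ℝ) : farInv Y ≤ 1 / 2 := by
  rw [farInv, one_div]
  exact inv_anti₀ two_pos (le_max_right _ _)

theorem le_farKer_arg {a : ℝ} (ha : |a| ≤ 1) (Y : Fin 4 → ℝ) :
    1 / 4 ≤ 1 + 2 * a * farInv Y * cos (Y 2) + a ^ 2 * farInv Y ^ 2 := by
  have h1 := farInv_pos Y
  have h2 := farInv_le Y
  have h3 : |a * farInv Y * cos (Y 2)| ≤ |a| * farInv Y := by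
    rw [abs_mul, abs_mul, abs_of_pos h1]
    exact mul_le_of_le_one_right (by positivity) (abs_cos_le_one _)
  have h4 : |a| * farInv Y ≤ 1 / 2 := by nlinarith [abs_nonneg a]
  have h5 : a ^ 2 * farInv Y ^ 2 = (|a| * farInv Y) ^ 2 := by rw [mul_pow, sq_abs]
  rw [h5]
  nlinarith [neg_abs_le (a * farInv Y * cos (Y 2)), abs_nonneg a]

theorem farKer_pos {a : ℝ} (ha : |a| ≤ 1) (Y : Fin 4 → ℝ) : 0 < farKer a Y := by
  have := le_farKer_arg ha Y
  unfold farKer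
  have h : 0 < √(1 + 2 * a * farInv Y * cos (Y 2) + a ^ 2 * farInv Y ^ 2) :=
    Real.sqrt_pos.mpr (by linarith)
  positivity

theorem farKer_le {a : ℝ} (ha : |a| ≤ 1) (Y : Fin 4 → ℝ) : farKer a Y ≤ 8 := by
  have h1 : (1 / 2 : ℝ) ≤ √(1 + 2 * a * farInv Y * cos (Y 2) + a ^ 2 * farInv Y ^ 2) :=
    Real.le_sqrt_of_sq_le (by linarith [le_farKer_arg ha Y])
  have h2 := inv_anti₀ (by norm_num) h1
  calc farKer a Y ≤ ((1 / 2 : ℝ)⁻¹) ^ 3 := by unfold farKer; gcongr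
    _ = 8 := by norm_num

theorem le_farKer {a : ℝ} (ha : 0 ≤ a) (ha' : a ≤ 1 / 100) (Y : Fin 4 → ℝ) :
    9 / 10 ≤ farKer a Y := by
  have h0 := le_farKer_arg (abs_le.mpr ⟨by linarith, by linarith⟩ : |a| ≤ 1) Y
  have h1 : √(1 + 2 * a * farInv Y * cos (Y 2) + a ^ 2 * farInv Y ^ 2) ≤ 101 / 100 := by
    refine Real.sqrt_le_iff.mpr ⟨by norm_num, ?_⟩
    have h3 : a * farInv Y * cos (Y 2) ≤ a * farInv Y :=
      mul_le_of_le_one_right (mul_nonneg ha (farInv_pos Y).le) (cos_le_one _)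
    have h4 : a * farInv Y ≤ 1 / 200 := by nlinarith [farInv_pos Y, farInv_le Y]
    have h5 : a ^ 2 * farInv Y ^ 2 = (a * farInv Y) ^ 2 := by ring
    have h6 : 0 ≤ a * farInv Y := mul_nonneg ha (farInv_pos Y).le
    rw [h5]
    nlinarith
  have h2 := inv_anti₀ (Real.sqrt_pos.mpr (by linarith)) h1
  calc (9 / 10 : ℝ) ≤ ((101 / 100 : ℝ)⁻¹) ^ 3 := by norm_num
    _ ≤ _ := by unfold farKer; gcongr

theorem bddLip_farInv : BddLip farInv := by
  refine BddLip.inv_of_le (C := 1) two_pos (fun x y => ?_) fun x => le_max_right _ _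
  refine (abs_max_sub_max_le_abs _ _ _).trans ?_
  simpa [Real.dist_eq] using dist_le_pi_dist x y 0

theorem bddLip_farKer {a : ℝ} (ha : |a| ≤ 1) : BddLip (farKer a) := by
  have h : BddLip fun Y : Fin 4 → ℝ =>
      1 + 2 * a * farInv Y * cos (Y 2) + a ^ 2 * farInv Y ^ 2 :=
    ((BddLip.const 1).add (((BddLip.const (2 * a)).mul bddLip_farInv).mul
      (BddLip.cos_coord 2))).add ((BddLip.const (a ^ 2)).mul (bddLip_farInv.pow 2))
  exact ((h.sqrt (by norm_num) (le_farKer_arg ha)).inv (ε := 1 / 2) (by norm_num) fun Y =>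
    Real.le_sqrt_of_sq_le (by linarith [le_farKer_arg ha Y])).pow 3

theorem bddLip_farField {μ : ℝ} (h0 : 0 ≤ μ) (h1 : μ ≤ 1) (i : Fin 4) :
    BddLip fun Y => farField μ Y i := by
  have hμ : |μ| ≤ 1 := abs_le.mpr ⟨by linarith, h1⟩
  have hμ' : |(-(1 - μ))| ≤ 1 := abs_le.mpr ⟨by linarith, by linarith⟩
  have c1 := BddLip.clamp_coord (zero_le_one' ℝ) (1 : Fin 4)
  have c3 := BddLip.clamp_coord (by norm_num : (0 : ℝ) ≤ 1 / 2) (3 : Fin 4)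
  have k1 := bddLip_farKer hμ
  have k2 := bddLip_farKer hμ'
  have hc := BddLip.cos_coord (2 : Fin 4)
  have hs := BddLip.sin_coord (2 : Fin 4)
  have hI := bddLip_farInv
  fin_cases i
  · exact c1
  · exact ((c3.pow 2).mul (hI.pow 3)).sub ((hI.pow 2).mul
      ((((BddLip.const (1 - μ)).mul ((BddLip.const 1).add (((BddLip.const μ).mul hI).mul hc))).mul
        k1).add (((BddLip.const μ).mul ((BddLip.const 1).add
          (((BddLip.const (-(1 - μ))).mul hI).mul hc))).mul k2)))
  · exact (c3.mul (hI.pow 2)).sub (BddLip.const 1)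
  · exact ((((BddLip.const (μ * (1 - μ))).mul (hI.pow 2)).mul hs).mul (k1.sub k2))

theorem farField_one_le
    {μ : ℝ} (h0 : 0 < μ) (h1 : μ ≤ 1 / 100)
    (Y : Fin 4 → ℝ) : farField μ Y 1 ≤ -(farInv Y ^ 2 / 4) := by
  have hs := farInv_pos Y
  have hs' := farInv_le Y
  have hc := abs_le.mp (abs_cos_le_one (Y 2))
  have k1 := le_farKer h0.le h1 Y
  have k2 := farKer_pos (abs_le.mpr ⟨by linarith, by linarith⟩ : |(-(1 - μ))| ≤ 1) Y
  have hG := abs_le.mp (abs_clampTo_le (by norm_num : (0 : ℝ) ≤ 1 / 2) (Y 3))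
  change clampTo (1 / 2) (Y 3) ^ 2 * farInv Y ^ 3 - farInv Y ^ 2 * (_ + _) ≤ _
  set c := cos (Y 2)
  set σ := farInv Y
  have hσc : |σ * c| ≤ 1 / 2 := by
    rw [abs_mul, abs_of_pos hs]
    nlinarith [abs_cos_le_one (Y 2), abs_nonneg (cos (Y 2))]
  obtain ⟨hl, hu⟩ := abs_le.mp hσc
  have e1 : 98 / 100 ≤ (1 - μ) * (1 + μ * σ * c) := by
    have : -(1 / 200) ≤ μ * (σ * c) := by nlinarith
    nlinarith
  have e2 : 88 / 100 ≤ (1 - μ) * (1 + μ * σ * c) * farKer μ Y := by nlinarith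
  have e3 : 0 ≤ μ * (1 + (-(1 - μ)) * σ * c) * farKer (-(1 - μ)) Y := by
    have : 0 ≤ 1 + (-(1 - μ)) * σ * c := by nlinarith
    positivity
  have e4 : clampTo (1 / 2) (Y 3) ^ 2 * σ ^ 3 ≤ σ ^ 2 / 8 := by
    have : clampTo (1 / 2) (Y 3) ^ 2 ≤ 1 / 4 := by nlinarith
    have : clampTo (1 / 2) (Y 3) ^ 2 * σ ≤ 1 / 8 := by
      nlinarith [sq_nonneg (clampTo (1 / 2) (Y 3))]
    nlinarith [sq_nonneg σ]
  nlinarith [sq_nonneg σ]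

theorem abs_farField_three_le
    {μ : ℝ} (h0 : 0 < μ) (h1 : μ ≤ 1 / 100)
    (Y : Fin 4 → ℝ) :
    |farField μ Y 3| ≤ 8 * μ * farInv Y ^ 2 := by
  have a1 : |μ| ≤ 1 := abs_le.mpr ⟨by linarith, by linarith⟩
  have a2 : |(-(1 - μ))| ≤ 1 := abs_le.mpr ⟨by linarith, by linarith⟩
  have hk : |farKer μ Y - farKer (-(1 - μ)) Y| ≤ 8 :=
    abs_sub_le_iff.mpr ⟨by linarith [farKer_le a1 Y, farKer_pos a2 Y],
      by linarith [farKer_le a2 Y, farKer_pos a1 Y]⟩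
  change |μ * (1 - μ) * farInv Y ^ 2 * sin (Y 2) * (farKer μ Y - farKer (-(1 - μ)) Y)| ≤ _
  rw [abs_mul, abs_mul, abs_of_nonneg (by have := sq_nonneg (farInv Y); have : 0 ≤ 1 - μ := by linarith
                                          positivity : 0 ≤ μ * (1 - μ) * farInv Y ^ 2)]
  calc μ * (1 - μ) * farInv Y ^ 2 * |sin (Y 2)| * |farKer μ Y - farKer (-(1 - μ)) Y|
      ≤ μ * 1 * farInv Y ^ 2 * 1 * 8 := by
        gcongr
        · linarith
        · exact abs_sin_le_one _
    _ = _ := by ring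

theorem strictAnti_far
    {μ : ℝ} (h0 : 0 < μ) (h1 : μ ≤ 1 / 100)
    {γ : ℝ → Fin 4 → ℝ} (hγ : ∀ t, HasDerivAt γ (farField μ (γ t)) t) : StrictAnti fun t => γ t 1 := by
  refine strictAnti_of_hasDerivAt_neg (fun t => (hasDerivAt_pi.mp (hγ t) 1)) fun t => ?_
  have := farField_one_le h0 h1 (γ t)
  have := farInv_pos (γ t)
  have : 0 < farInv (γ t) ^ 2 := by positivity
  linarith

theorem abs_angMom_sub_le
    {μ : ℝ} (h0 : 0 < μ) (h1 : μ ≤ 1 / 100)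
    {γ : ℝ → Fin 4 → ℝ} (hγ : ∀ t, HasDerivAt γ (farField μ (γ t)) t)
    {t : ℝ} (ht : 0 ≤ t) :
    |γ t 3 - γ 0 3| ≤ 32 * μ * (γ 0 1 - γ t 1) := by
  have hy := fun s => hasDerivAt_pi.mp (hγ s) 1
  have hG := fun s => hasDerivAt_pi.mp (hγ s) 3
  have b : ∀ s, |farField μ (γ s) 3| ≤ -(32 * μ * farField μ (γ s) 1) := fun s => by
    have := farField_one_le h0 h1 (γ s)
    have := abs_farField_three_le h0 h1 (γ s)
    nlinarith
  have m1 : Monotone fun s => γ s 3 - 32 * μ * γ s 1 :=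
    monotone_of_hasDerivAt_nonneg (fun s => (hG s).sub ((hy s).const_mul (32 * μ)))
      fun s => by
        change (0 : ℝ) ≤ _
        linarith [neg_abs_le (farField μ (γ s) 3), b s]
  have m2 : Antitone fun s => γ s 3 + 32 * μ * γ s 1 :=
    antitone_of_hasDerivAt_nonpos (fun s => (hG s).add ((hy s).const_mul (32 * μ)))
      fun s => by
        change _ ≤ (0 : ℝ)
        linarith [le_abs_self (farField μ (γ s) 3), b s]
  have e1 := m1 ht
  have e2 := m2 ht
  simp only at e1 e2
  exact abs_le.mpr ⟨by linarith, by linarith⟩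

theorem angle_le
    {μ : ℝ} (h0 : 0 < μ) (h1 : μ ≤ 1 / 100)
    {γ : ℝ → Fin 4 → ℝ} (hγ : ∀ t, HasDerivAt γ (farField μ (γ t)) t)
    {t : ℝ} (ht : 0 ≤ t) : γ t 2 ≤ γ 0 2 - t / 2 := by
  have ha := fun s => hasDerivAt_pi.mp (hγ s) 2
  have m : Antitone fun s => γ s 2 + s / 2 :=
    antitone_of_hasDerivAt_nonpos (fun s => (ha s).add ((hasDerivAt_id s).div_const 2))
      fun s => by
        change clampTo (1 / 2) (γ s 3) * farInv (γ s) ^ 2 - 1 + 1 / 2 ≤ (0 : ℝ)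
        have hG := abs_le.mp (abs_clampTo_le (by norm_num : (0 : ℝ) ≤ 1 / 2) (γ s 3))
        have := farInv_pos (γ s)
        have := farInv_le (γ s)
        have : farInv (γ s) ^ 2 ≤ 1 / 4 := by nlinarith
        nlinarith [sq_nonneg (farInv (γ s))]
  have := m ht
  simp only at this
  linarith

theorem radius_mono
    {μ : ℝ} (h0 : 0 < μ) (h1 : μ ≤ 1 / 100)
    {γ : ℝ → Fin 4 → ℝ} (hγ : ∀ t, HasDerivAt γ (farField μ (γ t)) t)
    {s t T : ℝ} (hT : 0 ≤ γ T 1) (hst : s ≤ t) (ht : t ≤ T) : γ s 0 ≤ γ t 0 := by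
  have hr := fun s => hasDerivAt_pi.mp (hγ s) 0
  have m : MonotoneOn (fun s => γ s 0) (Set.Iic T) := by
    refine monotoneOn_of_hasDerivWithinAt_nonneg (convex_Iic T)
      (fun s _ => (hr s).continuousAt.continuousWithinAt)
      (fun s _ => (hr s).hasDerivWithinAt) fun s hs => ?_
    have hs' : s ≤ T := Set.mem_Iic.mp (interior_subset hs)
    have : 0 ≤ γ s 1 := hT.trans ((strictAnti_far h0 h1 hγ).antitone hs')
    exact le_max_of_le_right (le_min zero_le_one this)
  exact m (hst.trans ht) ht hst

/-- If the radial velocity stays positive, the orbit is unbounded. -/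
theorem exists_radius_gt
    {μ : ℝ} (h0 : 0 < μ) (h1 : μ ≤ 1 / 100)
    {γ : ℝ → Fin 4 → ℝ} (hγ : ∀ t, HasDerivAt γ (farField μ (γ t)) t)
    (hpos : ∀ t, 0 ≤ t → 0 < γ t 1) (B : ℝ) : ∃ t, 0 ≤ t ∧ B < γ t 0 := by
  by_contra! hB
  set M := max B 2 with hM
  have hM2 : 0 < M := lt_of_lt_of_le two_pos (le_max_right _ _)
  have hy := fun s => hasDerivAt_pi.mp (hγ s) 1
  have m : AntitoneOn (fun s => γ s 1 + M⁻¹ ^ 2 / 4 * s) (Set.Ici 0) := by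
    refine antitoneOn_of_hasDerivWithinAt_nonpos (convex_Ici 0)
      (fun s _ => ((hy s).add ((hasDerivAt_id s).const_mul _)).continuousAt.continuousWithinAt)
      (fun s _ => ((hy s).add ((hasDerivAt_id s).const_mul _)).hasDerivWithinAt) fun s hs => ?_
    have hs' : 0 ≤ s := Set.mem_Ici.mp (interior_subset hs)
    have e := farField_one_le h0 h1 (γ s)
    have : M⁻¹ ≤ farInv (γ s) :=
      inv_anti₀ (lt_of_lt_of_le two_pos (le_max_right _ _)) (max_le_max (hB s hs') le_rfl)
    have : M⁻¹ ^ 2 ≤ farInv (γ s) ^ 2 := by gcongr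
    simp only [mul_one]
    linarith
  have hc : 0 < M⁻¹ ^ 2 / 4 := by positivity
  have hT : 0 ≤ γ 0 1 / (M⁻¹ ^ 2 / 4) := div_nonneg (hpos 0 le_rfl).le hc.le
  have e := m (Set.mem_Ici.mpr le_rfl) (Set.mem_Ici.mpr hT) hT
  simp only [mul_zero, add_zero] at e
  rw [mul_div_cancel₀ _ hc.ne'] at e
  linarith [hpos _ hT]

/-- First rotating barycentric coordinate of the polar state `(ρ, ρ', angle, angular momentum)`. -/
noncomputable def polQ1 (Y : Fin 4 → ℝ) : ℝ := Y 0 * cos (Y 2)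

/-- Second rotating barycentric coordinate of a polar state. -/
noncomputable def polQ2 (Y : Fin 4 → ℝ) : ℝ := Y 0 * sin (Y 2)

/-- First momentum of a polar state. -/
noncomputable def polP1 (Y : Fin 4 → ℝ) : ℝ := Y 1 * cos (Y 2) - Y 3 / Y 0 * sin (Y 2)

/-- Second momentum of a polar state. -/
noncomputable def polP2 (Y : Fin 4 → ℝ) : ℝ := Y 1 * sin (Y 2) + Y 3 / Y 0 * cos (Y 2)

theorem farKer_eq {a : ℝ} {Y : Fin 4 → ℝ} (hY : 2 ≤ Y 0) :
    farKer a Y = Y 0 ^ 3 / √((polQ1 Y + a) ^ 2 + polQ2 Y ^ 2) ^ 3 := by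
  have h0 : 0 < Y 0 := by linarith
  have e : (polQ1 Y + a) ^ 2 + polQ2 Y ^ 2 =
      Y 0 ^ 2 * (1 + 2 * a * farInv Y * cos (Y 2) + a ^ 2 * farInv Y ^ 2) := by
    rw [farInv, max_eq_left hY, polQ1, polQ2]
    have := sin_sq_add_cos_sq (Y 2)
    field_simp
    linear_combination Y 0 ^ 2 * this
  rw [e, Real.sqrt_mul (by positivity), Real.sqrt_sq h0.le, farKer, mul_pow]
  rw [← div_div, div_self (by positivity), inv_pow, one_div]

theorem le_sqrt_polar {a : ℝ} (ha : |a| ≤ 1) {Y : Fin 4 → ℝ} (hY : 2 ≤ Y 0) :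
    Y 0 / 2 ≤ √((polQ1 Y + a) ^ 2 + polQ2 Y ^ 2) := by
  refine Real.le_sqrt_of_sq_le ?_
  have e : (polQ1 Y + a) ^ 2 + polQ2 Y ^ 2 = Y 0 ^ 2 + 2 * Y 0 * (a * cos (Y 2)) + a ^ 2 := by
    rw [polQ1, polQ2]
    linear_combination Y 0 ^ 2 * sin_sq_add_cos_sq (Y 2)
  have h3 : |a * cos (Y 2)| ≤ |a| := by
    rw [abs_mul]
    exact mul_le_of_le_one_right (by positivity) (abs_cos_le_one _)
  rw [e, ← sq_abs a]
  nlinarith [neg_abs_le (a * cos (Y 2)), sq_nonneg (Y 0 - |a|), abs_nonneg a]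

theorem ham_polar {μ : ℝ} {Y : Fin 4 → ℝ} (hY : 2 ≤ Y 0) :
    Ham μ (polQ1 Y) (polQ2 Y) (polP1 Y) (polP2 Y) =
      Y 1 ^ 2 / 2 + (Y 3 / Y 0) ^ 2 / 2 - Y 3 - (1 - μ) / dS μ (polQ1 Y) (polQ2 Y)
        - μ / dJ μ (polQ1 Y) (polQ2 Y) := by
  have h0 : Y 0 ≠ 0 := by linarith
  rw [Ham]
  congr 2
  simp only [polQ1, polQ2, polP1, polP2]
  field_simp
  linear_combination (-2 * Y 0 ^ 2 * Y 3 + Y 0 ^ 2 * Y 1 ^ 2 + Y 3 ^ 2) *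
    sin_sq_add_cos_sq (Y 2)

theorem isPCRTBPSol_polar {μ : ℝ} (h0 : 0 < μ) (h1 : μ ≤ 1 / 100) {γ : ℝ → Fin 4 → ℝ}
    (hγ : ∀ t, HasDerivAt γ (farField μ (γ t)) t) {I : Set ℝ}
    (hI : ∀ t ∈ I, 2 ≤ γ t 0 ∧ |γ t 1| ≤ 1 ∧ |γ t 3| ≤ 1 / 2) :
    IsPCRTBPSol μ I (fun t => polQ1 (γ t)) (fun t => polQ2 (γ t)) (fun t => polP1 (γ t))
      (fun t => polP2 (γ t)) := by
  intro t ht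
  obtain ⟨hρ, hy, hG⟩ := hI t ht
  have hρ0 : γ t 0 ≠ 0 := by linarith
  have a1 : |μ| ≤ 1 := abs_le.mpr ⟨by linarith, by linarith⟩
  have a2 : |(-(1 - μ))| ≤ 1 := abs_le.mpr ⟨by linarith, by linarith⟩
  have k1 := farKer_eq (a := μ) hρ
  have k2 := farKer_eq (a := -(1 - μ)) hρ
  have s1 := le_sqrt_polar a1 hρ
  have s2 := le_sqrt_polar a2 hρ
  rw [← sub_eq_add_neg] at k2 s2
  change _ = _ / dS μ (polQ1 (γ t)) (polQ2 (γ t)) ^ 3 at k1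
  change _ = _ / dJ μ (polQ1 (γ t)) (polQ2 (γ t)) ^ 3 at k2
  change _ ≤ dS μ (polQ1 (γ t)) (polQ2 (γ t)) at s1
  change _ ≤ dJ μ (polQ1 (γ t)) (polQ2 (γ t)) at s2
  have d := fun i => hasDerivAt_pi.mp (hγ t) i
  have d0 : HasDerivAt (fun t => γ t 0) (γ t 1) t := (d 0).congr_deriv (clampTo_eq hy)
  have d2 : HasDerivAt (fun t => γ t 2) (γ t 3 * (γ t 0)⁻¹ ^ 2 - 1) t := (d 2).congr_deriv <| by
    change clampTo (1 / 2) (γ t 3) * farInv (γ t) ^ 2 - 1 = _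
    rw [clampTo_eq hG, farInv, max_eq_left hρ]
  have d3 : HasDerivAt (fun t => γ t 3) (μ * (1 - μ) * (γ t 0)⁻¹ ^ 2 * sin (γ t 2) *
      (farKer μ (γ t) - farKer (-(1 - μ)) (γ t))) t := (d 3).congr_deriv <| by
    change μ * (1 - μ) * farInv (γ t) ^ 2 * _ * _ = _
    rw [farInv, max_eq_left hρ]
  have d1 : HasDerivAt (fun t => γ t 1) (γ t 3 ^ 2 * (γ t 0)⁻¹ ^ 3 - (γ t 0)⁻¹ ^ 2 *
      ((1 - μ) * (1 + μ * (γ t 0)⁻¹ * cos (γ t 2)) * farKer μ (γ t) +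
        μ * (1 + (-(1 - μ)) * (γ t 0)⁻¹ * cos (γ t 2)) * farKer (-(1 - μ)) (γ t))) t :=
    (d 1).congr_deriv <| by
      change clampTo (1 / 2) (γ t 3) ^ 2 * farInv (γ t) ^ 3 - farInv (γ t) ^ 2 * _ = _
      rw [clampTo_eq hG, farInv, max_eq_left hρ]
  have hS3 : 0 < dS μ (polQ1 (γ t)) (polQ2 (γ t)) := by linarith
  have hJ3 : 0 < dJ μ (polQ1 (γ t)) (polQ2 (γ t)) := by linarith
  have f1 : ∀ x, x / dS μ (polQ1 (γ t)) (polQ2 (γ t)) ^ 3 =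
      x * (γ t 0)⁻¹ ^ 3 * farKer μ (γ t) := fun x => by
    rw [k1]; field_simp
  have f2 : ∀ x, x / dJ μ (polQ1 (γ t)) (polQ2 (γ t)) ^ 3 =
      x * (γ t 0)⁻¹ ^ 3 * farKer (-(1 - μ)) (γ t) := fun x => by
    rw [k2]; field_simp
  have dd := d3.div d0 hρ0
  have hsc := sin_sq_add_cos_sq (γ t 2)
  refine ⟨⟨fun h => ?_, fun h => ?_⟩, ?_, ?_, ?_, ?_⟩
  · simp only [Prod.mk.injEq] at h
    rw [h.1, h.2] at hS3
    simp [dS] at hS3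
  · simp only [Prod.mk.injEq] at h
    rw [h.1, h.2] at hJ3
    simp [dJ] at hJ3
  · refine (d0.mul d2.cos).congr_deriv ?_
    simp only [polP1, polQ2]
    field_simp
    ring
  · refine (d0.mul d2.sin).congr_deriv ?_
    simp only [polP2, polQ1]
    field_simp
    ring
  · refine ((d1.mul d2.cos).sub (dd.mul d2.sin)).congr_deriv ?_
    rw [f1, f2]
    simp only [polP2, polQ1, Pi.div_apply]
    generalize farKer μ (γ t) = K1
    generalize farKer (-(1 - μ)) (γ t) = K2
    generalize γ t 0 = r at hρ0 ⊢
    generalize γ t 1 = y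
    generalize γ t 3 = G
    generalize sin (γ t 2) = s at hsc ⊢
    generalize cos (γ t 2) = c at hsc ⊢
    field_simp
    linear_combination (-(μ * (1 - μ) * (K1 - K2))) * hsc
  · refine ((d1.mul d2.sin).add (dd.mul d2.cos)).congr_deriv ?_
    rw [f1, f2]
    simp only [polP1, polQ2, Pi.div_apply]
    generalize farKer μ (γ t) = K1
    generalize farKer (-(1 - μ)) (γ t) = K2
    generalize γ t 0 = r at hρ0 ⊢
    generalize γ t 1 = y
    generalize γ t 3 = G
    generalize sin (γ t 2) = s at hsc ⊢
    generalize cos (γ t 2) = c at hsc ⊢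
    field_simp
    ring

theorem far_bounds
    {μ : ℝ} (h0 : 0 < μ) (h1 : μ ≤ 1 / 200) {γ : ℝ → Fin 4 → ℝ}
    (hγ : ∀ t, HasDerivAt γ (farField μ (γ t)) t)
    (hρ : 2 ≤ γ 0 0) (hy : γ 0 1 ≤ 1) (hG : |γ 0 3| ≤ 1 / 4)
    {t T : ℝ} (hT : 0 ≤ γ T 1) (ht : t ∈ Set.Icc 0 T) :
    2 ≤ γ t 0 ∧ |γ t 1| ≤ 1 ∧ |γ t 3| ≤ 1 / 2 := by
  have h1' : μ ≤ 1 / 100 := by linarith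
  have hy0 : 0 ≤ γ t 1 := hT.trans ((strictAnti_far h0 h1' hγ).antitone ht.2)
  have hy1 : γ t 1 ≤ γ 0 1 := (strictAnti_far h0 h1' hγ).antitone ht.1
  have e := abs_le.mp (abs_angMom_sub_le h0 h1' hγ ht.1)
  have hG' := abs_le.mp hG
  have : 32 * μ * (γ 0 1 - γ t 1) ≤ 1 / 4 := by nlinarith
  exact ⟨hρ.trans (radius_mono h0 h1' hγ hT ht.1 ht.2),
    abs_le.mpr ⟨by linarith, by linarith⟩, abs_le.mpr ⟨by linarith, by linarith⟩⟩

theorem isPCRTBPSol_far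
    {μ : ℝ} (h0 : 0 < μ) (h1 : μ ≤ 1 / 200) {γ : ℝ → Fin 4 → ℝ}
    (hγ : ∀ t, HasDerivAt γ (farField μ (γ t)) t)
    (hρ : 2 ≤ γ 0 0) (hy : γ 0 1 ≤ 1) (hG : |γ 0 3| ≤ 1 / 4)
    {T : ℝ} (hT : 0 ≤ γ T 1) :
    IsPCRTBPSol μ (Set.Icc 0 T) (fun t => polQ1 (γ t)) (fun t => polQ2 (γ t))
      (fun t => polP1 (γ t)) (fun t => polP2 (γ t)) :=
  isPCRTBPSol_polar h0 (by linarith) hγ fun _ ht => far_bounds h0 h1 hγ hρ hy hG hT ht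

theorem ham_far
    {μ : ℝ} (h0 : 0 < μ) (h1 : μ ≤ 1 / 200) {γ : ℝ → Fin 4 → ℝ}
    (hγ : ∀ t, HasDerivAt γ (farField μ (γ t)) t)
    (hρ : 2 ≤ γ 0 0) (hy : γ 0 1 ≤ 1) (hG : |γ 0 3| ≤ 1 / 4)
    {h : ℝ} (hH : Ham μ (polQ1 (γ 0)) (polQ2 (γ 0)) (polP1 (γ 0)) (polP2 (γ 0)) = h)
    {T : ℝ} (h0T : 0 ≤ T) (hT : 0 ≤ γ T 1) :
    γ T 1 ^ 2 / 2 + (γ T 3 / γ T 0) ^ 2 / 2 - γ T 3 - (1 - μ) / dS μ (polQ1 (γ T)) (polQ2 (γ T))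
        - μ / dJ μ (polQ1 (γ T)) (polQ2 (γ T)) = h := by
  rw [← ham_polar (far_bounds h0 h1 hγ hρ hy hG hT (Set.right_mem_Icc.mpr h0T)).1, ← hH]
  exact (isPCRTBPSol_far h0 h1 hγ hρ hy hG hT).ham_eq (convex_Icc 0 T)
    (Set.right_mem_Icc.mpr h0T) (Set.left_mem_Icc.mpr h0T)

/-- Orbits with sufficiently large angular momentum escape. -/
theorem radial_pos_of_le_angMom
    {μ : ℝ} (h0 : 0 < μ) (h1 : μ ≤ 1 / 200) {γ : ℝ → Fin 4 → ℝ}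
    (hγ : ∀ t, HasDerivAt γ (farField μ (γ t)) t)
    (hρ : 2 ≤ γ 0 0) (hy : γ 0 1 ≤ 1) (hG : |γ 0 3| ≤ 1 / 4)
    {h : ℝ} (hH : Ham μ (polQ1 (γ 0)) (polQ2 (γ 0)) (polP1 (γ 0)) (polP2 (γ 0)) = h)
    (hh : -μ < h) (hy0 : 0 < γ 0 1) (hG0 : 34 * μ ≤ γ 0 3)
    {t : ℝ} (ht : 0 ≤ t) : 0 < γ t 1 := by
  by_contra! hneg
  have hc : Continuous fun t => γ t 1 :=
    continuous_iff_continuousAt.mpr fun t => (hasDerivAt_pi.mp (hγ t) 1).continuousAt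
  obtain ⟨T, hT, hT0⟩ := intermediate_value_Icc' ht hc.continuousOn ⟨hneg, hy0.le⟩
  simp only at hT0
  obtain ⟨b0, -, b3⟩ := far_bounds h0 h1 hγ hρ hy hG hT0.ge (Set.right_mem_Icc.mpr hT.1)
  have hham := ham_far h0 h1 hγ hρ hy hG hH hT.1 hT0.ge
  have e := abs_le.mp (abs_angMom_sub_le h0 (by linarith) hγ hT.1)
  have hJ : 0 ≤ μ / dJ μ (polQ1 (γ T)) (polQ2 (γ T)) := div_nonneg h0.le (Real.sqrt_nonneg _)
  have hS : dS μ (polQ1 (γ T)) (polQ2 (γ T)) ≤ 2 * γ T 0 := by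
    refine Real.sqrt_le_iff.mpr ⟨by linarith, ?_⟩
    have e : (polQ1 (γ T) + μ) ^ 2 + polQ2 (γ T) ^ 2 =
        γ T 0 ^ 2 + 2 * γ T 0 * μ * cos (γ T 2) + μ ^ 2 := by
      rw [polQ1, polQ2]
      linear_combination γ T 0 ^ 2 * sin_sq_add_cos_sq (γ T 2)
    have : γ T 0 * μ * cos (γ T 2) ≤ γ T 0 * μ :=
      mul_le_of_le_one_right (by positivity) (cos_le_one _)
    nlinarith
  have hS0 : 0 < dS μ (polQ1 (γ T)) (polQ2 (γ T)) := by
    have := le_sqrt_polar (a := μ) (abs_le.mpr ⟨by linarith, by linarith⟩) b0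
    exact lt_of_lt_of_le (by linarith) this
  have hS1 : (1 / 4) / γ T 0 ≤ (1 - μ) / dS μ (polQ1 (γ T)) (polQ2 (γ T)) := by
    rw [div_le_div_iff₀ (by linarith) hS0]
    nlinarith
  have hq : (γ T 3 / γ T 0) ^ 2 / 2 ≤ (1 / 4) / γ T 0 := by
    rw [div_pow, div_div, div_le_div_iff₀ (by positivity) (by linarith)]
    have : γ T 3 ^ 2 ≤ 1 / 4 := by rw [← sq_abs]; nlinarith [abs_nonneg (γ T 3)]
    nlinarith
  rw [hT0] at hham e
  have : 32 * μ * (γ 0 1 - 0) ≤ 32 * μ := by nlinarith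
  nlinarith

/-- Orbits with sufficiently negative angular momentum reach an apsis. -/
theorem exists_radial_nonpos_of_angMom_le
    {μ : ℝ} (h0 : 0 < μ) (h1 : μ ≤ 1 / 200) {γ : ℝ → Fin 4 → ℝ}
    (hγ : ∀ t, HasDerivAt γ (farField μ (γ t)) t)
    (hρ : 2 ≤ γ 0 0) (hy : γ 0 1 ≤ 1) (hG : |γ 0 3| ≤ 1 / 4)
    {h : ℝ} (hH : Ham μ (polQ1 (γ 0)) (polQ2 (γ 0)) (polP1 (γ 0)) (polP2 (γ 0)) = h)
    (hh : h < μ) (hG0 : γ 0 3 ≤ -(34 * μ)) :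
    ∃ t, 0 ≤ t ∧ γ t 1 ≤ 0 := by
  by_contra! hpos
  obtain ⟨T, hT, hB⟩ := exists_radius_gt h0 (by linarith) hγ hpos (4 / μ)
  have hTp := hpos T hT
  obtain ⟨b0, -, b3⟩ := far_bounds h0 h1 hγ hρ hy hG hTp.le (Set.right_mem_Icc.mpr hT)
  have hham := ham_far h0 h1 hγ hρ hy hG hH hT hTp.le
  have e := abs_le.mp (abs_angMom_sub_le h0 (by linarith) hγ hT)
  have s1 := le_sqrt_polar (a := μ) (abs_le.mpr ⟨by linarith, by linarith⟩) b0
  have s2 := le_sqrt_polar (a := -(1 - μ)) (abs_le.mpr ⟨by linarith, by linarith⟩) b0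
  rw [← sub_eq_add_neg] at s2
  change _ ≤ dS μ (polQ1 (γ T)) (polQ2 (γ T)) at s1
  change _ ≤ dJ μ (polQ1 (γ T)) (polQ2 (γ T)) at s2
  have e1 : (1 - μ) / dS μ (polQ1 (γ T)) (polQ2 (γ T)) ≤ (1 - μ) / (γ T 0 / 2) :=
    div_le_div_of_nonneg_left (by linarith) (by linarith) s1
  have e2 : μ / dJ μ (polQ1 (γ T)) (polQ2 (γ T)) ≤ μ / (γ T 0 / 2) :=
    div_le_div_of_nonneg_left (by linarith) (by linarith) s2
  have e3 : (1 - μ) / (γ T 0 / 2) + μ / (γ T 0 / 2) < μ := by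
    rw [← add_div, div_lt_iff₀ (by linarith)]
    rw [div_lt_iff₀ h0] at hB
    nlinarith
  have : 32 * μ * (γ 0 1 - γ T 1) ≤ 32 * μ := by nlinarith
  nlinarith [sq_nonneg (γ T 1), sq_nonneg (γ T 3 / γ T 0)]

theorem continuous_flow_of_nonneg {E : Type*} [NormedAddCommGroup E] [NormedSpace ℝ E]
    {f : E → E} {K : NNReal} (hK : LipschitzWith K f) {Φ : E → ℝ → E} (hΦ0 : ∀ x, Φ x 0 = x)
    (hΦ : ∀ x t, HasDerivAt (Φ x) (f (Φ x t)) t) :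
    Continuous fun p : E × ℝ => Φ p.1 (max p.2 0) := by
  refine continuous_iff_continuousAt.mpr fun p => tendsto_iff_dist_tendsto_zero.mpr ?_
  have hc : Continuous (Φ p.1) :=
    continuous_iff_continuousAt.mpr fun t => (hΦ p.1 t).continuousAt
  have h1 : Continuous fun q : E × ℝ => dist q.1 p.1 * exp (K * max q.2 0) +
      dist (Φ p.1 (max q.2 0)) (Φ p.1 (max p.2 0)) := by fun_prop
  refine squeeze_zero (fun _ => dist_nonneg) (fun q => ?_)
    (by simpa using h1.tendsto p)
  refine (dist_triangle _ (Φ p.1 (max q.2 0)) _).trans (add_le_add ?_ le_rfl)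
  have := dist_flow_le hK (fun t _ => hΦ q.1 t) (fun t _ => hΦ p.1 t) (max q.2 0)
    (Set.right_mem_Icc.mpr (le_max_right _ _))
  rwa [hΦ0, hΦ0] at this

/-- A family of orbits passing from returning to escaping contains apses that are arbitrarily far
away and lie on the symmetry axis. -/
theorem exists_far_axis_apsis {a b : ℝ} (hab : a ≤ b) {y ρ α : ℝ → ℝ → ℝ}
    (cy : Continuous fun p : ℝ × ℝ => y p.1 (max p.2 0))
    (cρ : Continuous fun p : ℝ × ℝ => ρ p.1 (max p.2 0))
    (cα : Continuous fun p : ℝ × ℝ => α p.1 (max p.2 0))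
    (hy : ∀ θ, StrictAnti (y θ)) (hy0 : ∀ θ, 0 < y θ 0)
    (ha : ∃ t, 0 ≤ t ∧ y a t ≤ 0) (hb : ∀ t, 0 ≤ t → 0 < y b t)
    (hα : ∀ θ t, 0 ≤ t → α θ t ≤ α θ 0 - t / 2)
    (hρ : ∀ θ s T, 0 ≤ y θ T → s ≤ T → ρ θ s ≤ ρ θ T)
    (hesc : ∀ θ, (∀ t, 0 ≤ t → 0 < y θ t) → ∀ B, ∃ t, 0 ≤ t ∧ B < ρ θ t) (B : ℝ) :
    ∃ θ ∈ Set.Icc a b, ∃ T, 0 < T ∧ y θ T = 0 ∧ sin (α θ T) = 0 ∧ B < ρ θ T := by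
  have cy' : ∀ t, 0 ≤ t → Continuous fun θ => y θ t := fun t ht => by
    have := cy.comp (Continuous.prodMk_left t)
    simpa [Function.comp_def, max_eq_left ht] using this
  have cρ' : ∀ t, 0 ≤ t → Continuous fun θ => ρ θ t := fun t ht => by
    have := cρ.comp (Continuous.prodMk_left t)
    simpa [Function.comp_def, max_eq_left ht] using this
  have cα' : ∀ t, 0 ≤ t → Continuous fun θ => α θ t := fun t ht => by
    have := cα.comp (Continuous.prodMk_left t)
    simpa [Function.comp_def, max_eq_left ht] using this
  set A : Set ℝ := {θ | θ ∈ Set.Icc a b ∧ ∀ t, 0 ≤ t → 0 < y θ t} with hA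
  have hAeq : A = Set.Icc a b ∩ ⋂ t : ℝ, ⋂ _ : 0 ≤ t, {θ | 0 ≤ y θ t} := by
    ext θ
    simp only [hA, Set.mem_ofPred_eq, Set.mem_inter_iff, Set.mem_iInter]
    refine and_congr_right fun _ => ⟨fun h t ht => (h t ht).le, fun h t ht => ?_⟩
    exact (h (t + 1) (by linarith)).trans_lt (hy θ (lt_add_one t))
  have hAc : IsClosed A := by
    rw [hAeq]
    exact isClosed_Icc.inter (isClosed_iInter fun t => isClosed_iInter fun ht =>
      isClosed_le continuous_const (cy' t ht))
  have hbA : b ∈ A := ⟨⟨hab, le_rfl⟩, hb⟩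
  have hAb : BddBelow A := ⟨a, fun θ hθ => hθ.1.1⟩
  set θs := sInf A with hθs
  have hsA : θs ∈ A := hAc.csInf_mem ⟨b, hbA⟩ hAb
  have has : a < θs := by
    refine lt_of_le_of_ne hsA.1.1 fun h => ?_
    obtain ⟨t, ht, hyt⟩ := ha
    rw [h] at hyt
    exact absurd (hsA.2 t ht) hyt.not_gt
  have hT : ∀ θ ∈ Set.Ico a θs, ∃ T, 0 < T ∧ y θ T = 0 := fun θ hθ => by
    have hn : θ ∉ A := notMem_of_lt_csInf hθ.2 hAb
    have : ∃ t, 0 ≤ t ∧ y θ t ≤ 0 := by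
      by_contra! h
      exact hn ⟨⟨hθ.1, hθ.2.le.trans hsA.1.2⟩, h⟩
    obtain ⟨t, ht, hyt⟩ := this
    have hc : ContinuousOn (fun t => y θ t) (Set.Icc 0 t) := by
      refine (cy.comp (Continuous.prodMk_right θ)).continuousOn.congr fun s hs => ?_
      simp [max_eq_left hs.1]
    obtain ⟨T, hT, hT0⟩ := intermediate_value_Icc' ht hc ⟨hyt, (hy0 θ).le⟩
    refine ⟨T, lt_of_le_of_ne hT.1 fun h => ?_, hT0⟩
    rw [← h] at hT0
    exact (hy0 θ).ne' hT0
  choose! T hT0 hTy using hT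
  have hTlt : ∀ θ ∈ Set.Ico a θs, ∀ t, 0 < y θ t → t < T θ := fun θ hθ t ht => by
    rw [← hTy θ hθ] at ht
    exact (hy θ).lt_iff_gt.mp ht
  have hTc : ContinuousOn T (Set.Ico a θs) := by
    intro θ hθ
    refine Metric.tendsto_nhds.mpr fun ε hε => ?_
    set δ := min ε (T θ) / 2 with hδ
    have hδ0 : 0 < δ := by have := lt_min hε (hT0 θ hθ); positivity
    have hδε : δ < ε := by linarith [min_le_left ε (T θ)]
    have hδT : δ ≤ T θ := by linarith [min_le_right ε (T θ), hT0 θ hθ]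
    have l1 : 0 < y θ (T θ - δ) := by rw [← hTy θ hθ]; exact hy θ (by linarith)
    have l2 : y θ (T θ + δ) < 0 := by rw [← hTy θ hθ]; exact hy θ (by linarith)
    have e1 := (cy' (T θ - δ) (by linarith)).continuousAt.eventually (lt_mem_nhds l1)
    have e2 := (cy' (T θ + δ) (by linarith)).continuousAt.eventually (gt_mem_nhds l2)
    filter_upwards [mem_nhdsWithin_of_mem_nhds e1, mem_nhdsWithin_of_mem_nhds e2,
      self_mem_nhdsWithin] with θ' h1 h2 hθ'
    have g1 := hTlt θ' hθ' _ h1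
    have g2 : T θ' < T θ + δ := by
      rw [← hTy θ' hθ'] at h2
      exact (hy θ').lt_iff_gt.mp h2
    rw [Real.dist_eq]
    exact abs_lt.mpr ⟨by linarith, by linarith⟩
  have hαc : ContinuousOn (fun θ => α θ (T θ)) (Set.Ico a θs) := by
    refine (cα.comp_continuousOn (continuousOn_id.prodMk hTc)).congr fun θ hθ => ?_
    simp [max_eq_left (hT0 θ hθ).le]
  obtain ⟨τ, hτ, hτB⟩ := hesc θs hsA.2 B
  have ev1 : ∀ᶠ θ in 𝓝 θs, B < ρ θ τ ∧ 0 < y θ τ :=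
    ((cρ' τ hτ).continuousAt.eventually (lt_mem_nhds hτB)).and
      ((cy' τ hτ).continuousAt.eventually (lt_mem_nhds (hsA.2 τ hτ)))
  obtain ⟨l, hl, hlI⟩ := exists_Ioc_subset_of_mem_nhds' ev1 has
  set θ₁ := (l + θs) / 2 with hθ₁
  have hθ₁I : θ₁ ∈ Set.Ico a θs := ⟨by linarith [hl.1, hl.2], by linarith [hl.2]⟩
  have hθ₁l : l < θ₁ := by linarith [hl.2]
  obtain ⟨n, hn⟩ := exists_nat_gt (-(α θ₁ (T θ₁)) / π)
  have hn' : (-(n : ℝ)) * π ≤ α θ₁ (T θ₁) := by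
    rw [div_lt_iff₀ pi_pos] at hn
    linarith
  set c := (-(n : ℝ)) * π with hc
  set τ' := max 0 (2 * (α θs 0 + 1 - c)) with hτ'
  have hτ'0 : 0 ≤ τ' := le_max_left _ _
  have ev2 : ∀ᶠ θ in 𝓝 θs, α θ 0 < α θs 0 + 1 ∧ 0 < y θ τ' :=
    ((cα' 0 le_rfl).continuousAt.eventually (gt_mem_nhds (lt_add_one _))).and
      ((cy' τ' hτ'0).continuousAt.eventually (lt_mem_nhds (hsA.2 τ' hτ'0)))
  obtain ⟨θ₂, h1, h2, h3⟩ : ∃ θ₂, θ₁ < θ₂ ∧ θ₂ < θs ∧ α θ₂ 0 < α θs 0 + 1 ∧ 0 < y θ₂ τ' := by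
    obtain ⟨l', hl', hI'⟩ := exists_Ioc_subset_of_mem_nhds' ev2 hθ₁I.2
    exact ⟨(l' + θs) / 2, by linarith [hl'.1, hl'.2], by linarith [hl'.2],
      hI' ⟨by linarith [hl'.2], by linarith [hl'.2]⟩⟩
  have hθ₂I : θ₂ ∈ Set.Ico a θs := ⟨hθ₁I.1.trans h1.le, h2⟩
  have hlow : α θ₂ (T θ₂) ≤ c := by
    have k1 := hα θ₂ (T θ₂) (hT0 θ₂ hθ₂I).le
    have k2 := hTlt θ₂ hθ₂I τ' h3.2
    have k3 : 2 * (α θs 0 + 1 - c) ≤ τ' := le_max_right _ _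
    linarith [h3.1]
  obtain ⟨θ, hθ, hθc⟩ := intermediate_value_Icc' h1.le
    (hαc.mono fun θ hθ => ⟨hθ₁I.1.trans hθ.1, hθ.2.trans_lt h2⟩) ⟨hlow, hn'⟩
  have hθI : θ ∈ Set.Ico a θs := ⟨hθ₁I.1.trans hθ.1, hθ.2.trans_lt h2⟩
  have hfar := hlI ⟨hθ₁l.trans_le hθ.1, hθI.2.le⟩
  refine ⟨θ, ⟨hθI.1, hθI.2.le.trans hsA.1.2⟩, T θ, hT0 θ hθI, hTy θ hθI, ?_, ?_⟩
  · simp only at hθc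
    rw [hθc, hc, neg_mul, sin_neg, sin_nat_mul_pi, neg_zero]
  · exact hfar.1.trans_le (hρ θ τ _ (hTy θ hθI).ge (hTlt θ hθI τ hfar.2).le)

/-- Every suitable arc of polar data contains points whose orbits reach an arbitrarily far
perpendicular crossing of the symmetry axis. -/
theorem exists_far_arc {μ h a b : ℝ} (h0 : 0 < μ) (h1 : μ ≤ 1 / 200) (hh : |h| < μ) (hab : a ≤ b)
    {Y : ℝ → Fin 4 → ℝ} (hc : ContinuousOn Y (Set.Icc a b))
    (hρ : ∀ θ ∈ Set.Icc a b, 2 ≤ Y θ 0) (hy0 : ∀ θ ∈ Set.Icc a b, 0 < Y θ 1)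
    (hy : ∀ θ ∈ Set.Icc a b, Y θ 1 ≤ 1) (hG : ∀ θ ∈ Set.Icc a b, |Y θ 3| ≤ 1 / 4)
    (hH : ∀ θ ∈ Set.Icc a b,
      Ham μ (polQ1 (Y θ)) (polQ2 (Y θ)) (polP1 (Y θ)) (polP2 (Y θ)) = h)
    (ha : Y a 3 ≤ -(34 * μ)) (hb : 34 * μ ≤ Y b 3) (B : ℝ) :
    ∃ θ ∈ Set.Icc a b, ∃ T, 0 < T ∧ ∃ q1 q2 p1 p2 : ℝ → ℝ,
      IsPCRTBPSol μ (Set.Icc 0 T) q1 q2 p1 p2 ∧ q1 0 = polQ1 (Y θ) ∧ q2 0 = polQ2 (Y θ) ∧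
      p1 0 = polP1 (Y θ) ∧ p2 0 = polP2 (Y θ) ∧ q2 T = 0 ∧ p1 T = 0 ∧ B < nrm2 (q1 T) (q2 T) := by
  obtain ⟨hh1, hh2⟩ := abs_lt.mp hh
  have h1' : μ ≤ 1 / 100 := by linarith
  obtain ⟨Φ, K, hK, hΦ0, hΦ⟩ := exists_flow_of_bddLip (bddLip_farField h0.le (by linarith : μ ≤ 1))
  set Z : ℝ → Fin 4 → ℝ := fun θ => Y (max a (min b θ)) with hZ
  have hm : ∀ θ, max a (min b θ) ∈ Set.Icc a b := fun θ =>
    ⟨le_max_left _ _, max_le hab (min_le_left _ _)⟩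
  have hm' : ∀ θ ∈ Set.Icc a b, max a (min b θ) = θ := fun θ hθ => by
    rw [min_eq_right hθ.2, max_eq_right hθ.1]
  have cZ : Continuous Z := hc.comp_continuous (by fun_prop) hm
  have cΦ : Continuous fun p : ℝ × ℝ => Φ (Z p.1) (max p.2 0) :=
    (continuous_flow_of_nonneg hK hΦ0 hΦ).comp ((cZ.comp continuous_fst).prodMk continuous_snd)
  have cΦ' : ∀ i, Continuous fun p : ℝ × ℝ => Φ (Z p.1) (max p.2 0) i := fun i =>
    (continuous_apply i).comp cΦ
  have zρ : ∀ θ, 2 ≤ Φ (Z θ) 0 0 := fun θ => by rw [hΦ0]; exact hρ _ (hm θ)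
  have zy0 : ∀ θ, 0 < Φ (Z θ) 0 1 := fun θ => by rw [hΦ0]; exact hy0 _ (hm θ)
  have zy : ∀ θ, Φ (Z θ) 0 1 ≤ 1 := fun θ => by rw [hΦ0]; exact hy _ (hm θ)
  have zG : ∀ θ, |Φ (Z θ) 0 3| ≤ 1 / 4 := fun θ => by rw [hΦ0]; exact hG _ (hm θ)
  have zH : ∀ θ, Ham μ (polQ1 (Φ (Z θ) 0)) (polQ2 (Φ (Z θ) 0)) (polP1 (Φ (Z θ) 0))
      (polP2 (Φ (Z θ) 0)) = h := fun θ => by rw [hΦ0]; exact hH _ (hm θ)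
  obtain ⟨θ, hθ, T, hT, hyT, hs, hB⟩ := exists_far_axis_apsis hab (cΦ' 1) (cΦ' 0) (cΦ' 2)
    (fun θ => strictAnti_far h0 h1' (hΦ (Z θ))) zy0
    (exists_radial_nonpos_of_angMom_le h0 h1 (hΦ _) (zρ _) (zy _) (zG _) (zH _) hh2
      (by rw [hΦ0]; simp only [hZ]; rwa [hm' a ⟨le_rfl, hab⟩]))
    (fun t ht => radial_pos_of_le_angMom h0 h1 (hΦ _) (zρ _) (zy _) (zG _) (zH _) hh1 (zy0 _)
      (by rw [hΦ0]; simp only [hZ]; rwa [hm' b ⟨hab, le_rfl⟩]) ht)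
    (fun θ t ht => angle_le h0 h1' (hΦ (Z θ)) ht)
    (fun θ s T hT hs => radius_mono h0 h1' (hΦ (Z θ)) hT hs le_rfl)
    (fun θ hpos B => exists_radius_gt h0 h1' (hΦ (Z θ)) hpos B) (max B 0)
  have hZθ : Z θ = Y θ := by simp only [hZ, hm' θ hθ]
  refine ⟨θ, hθ, T, hT, _, _, _, _,
    isPCRTBPSol_far h0 h1 (hΦ (Z θ)) (zρ θ) (zy θ) (zG θ) hyT.ge, ?_, ?_, ?_, ?_, ?_, ?_, ?_⟩
  · simp only [hΦ0, hZθ]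
  · simp only [hΦ0, hZθ]
  · simp only [hΦ0, hZθ]
  · simp only [hΦ0, hZθ]
  · simp only [polQ2, hs, mul_zero]
  · simp only [polP1, hs, hyT, mul_zero, zero_mul, sub_zero]
  · have hc2 : cos (Φ (Z θ) T 2) ^ 2 = 1 := by
      have := sin_sq_add_cos_sq (Φ (Z θ) T 2)
      rw [hs] at this
      linarith
    have hn : nrm2 (polQ1 (Φ (Z θ) T)) (polQ2 (Φ (Z θ) T)) = Φ (Z θ) T 0 := by
      rw [nrm2, polQ1, polQ2, hs, mul_pow, hc2]
      simp only [mul_one, mul_zero, ne_eq, OfNat.ofNat_ne_zero, not_false_eq_true, zero_pow,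
        add_zero]
      exact Real.sqrt_sq (((le_max_right B 0).trans_lt hB).le)
    simp only [hn]
    exact (le_max_left B 0).trans_lt hB

/-- A strictly increasing change of time can be inverted differentiably. -/
theorem exists_inverse_time {τ ρ : ℝ → ℝ} {S : ℝ} (hS : 0 ≤ S)
    (hτ : ∀ s ∈ Set.Icc 0 S, HasDerivAt τ (ρ s) s) (hpos : ∀ s ∈ Set.Ioo 0 S, 0 < ρ s) :
    ∃ σ : ℝ → ℝ, Continuous σ ∧ (∀ s ∈ Set.Icc 0 S, σ (τ s) = s) ∧
      ∀ s ∈ Set.Ioo 0 S, HasDerivAt σ (ρ s)⁻¹ (τ s) := by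
  have hc : ContinuousOn τ (Set.Icc 0 S) := fun s hs => (hτ s hs).continuousAt.continuousWithinAt
  have hm : StrictMonoOn τ (Set.Icc 0 S) := by
    refine strictMonoOn_of_deriv_pos (convex_Icc 0 S) hc fun s hs => ?_
    rw [interior_Icc] at hs
    rw [(hτ s (Set.Ioo_subset_Icc_self hs)).deriv]
    exact hpos s hs
  set π' : ℝ → ℝ := fun s => max 0 (min S s) with hπ
  have hπm : ∀ s, π' s ∈ Set.Icc 0 S := fun s =>
    ⟨le_max_left _ _, max_le hS (min_le_left _ _)⟩
  have hπe : ∀ s ∈ Set.Icc 0 S, π' s = s := fun s hs => by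
    simp only [hπ, min_eq_right hs.2, max_eq_right hs.1]
  have hπc : Continuous π' := by fun_prop
  have hπmono : Monotone π' := fun s t h => max_le_max le_rfl (min_le_min le_rfl h)
  have hπdiff : ∀ s t, s ≤ t → π' t - π' s ≤ t - s := fun s t h => by
    simp only [hπ]
    rcases le_total S s with h1 | h1 <;> rcases le_total S t with h2 | h2 <;>
      rcases le_total 0 s with h3 | h3 <;> rcases le_total 0 t with h4 | h4 <;>
      simp only [h1, h2, h3, h4, hS, min_eq_left, min_eq_right, max_eq_left, max_eq_right] <;>
      linarith
  set T : ℝ → ℝ := fun s => τ (π' s) + (s - π' s) with hT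
  have hTc : Continuous T :=
    (hc.comp_continuous hπc hπm).add (continuous_id.sub hπc)
  have hTm : StrictMono T := fun s t h => by
    have h1 := hπdiff s t h.le
    have h2 := hm.monotoneOn (hπm s) (hπm t) (hπmono h.le)
    simp only [hT]
    rcases (hπmono h.le).eq_or_lt with h3 | h3
    · rw [h3]; linarith
    · have := hm (hπm s) (hπm t) h3
      linarith
  have hTe : ∀ s ∈ Set.Icc 0 S, T s = τ s := fun s hs => by simp [hT, hπe s hs]
  have hTs : Function.Surjective T := by
    have hb : ∀ s, τ 0 ≤ τ (π' s) ∧ τ (π' s) ≤ τ S := fun s =>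
      ⟨hm.monotoneOn ⟨le_rfl, hS⟩ (hπm s) (hπm s).1,
        hm.monotoneOn (hπm s) ⟨hS, le_rfl⟩ (hπm s).2⟩
    refine hTc.surjective ?_ ?_
    · refine tendsto_atTop_mono (fun s => ?_) (tendsto_atTop_add_const_left atTop (τ 0 - S) tendsto_id)
      simp only [hT, id]
      linarith [(hb s).1, (hπm s).2]
    · refine tendsto_atBot_mono (fun s => ?_) (tendsto_atBot_add_const_left atBot (τ S) tendsto_id)
      simp only [hT, id]
      linarith [(hb s).2, (hπm s).1]
  set e := hTm.orderIsoOfSurjective T hTs with he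
  have hes : ∀ s, e.symm (T s) = s := fun s => e.symm_apply_apply s
  refine ⟨e.symm, e.symm.continuous, fun s hs => by rw [← hTe s hs, hes], fun s hs => ?_⟩
  have hs' := Set.Ioo_subset_Icc_self hs
  rw [← hTe s hs']
  refine HasDerivAt.of_local_left_inverse (f := T) e.symm.continuous.continuousAt ?_
    (hpos s hs).ne' (Eventually.of_forall fun t => e.apply_symm_apply t)
  rw [hes]
  refine (hτ s hs').congr_of_eventuallyEq ?_
  filter_upwards [Ioo_mem_nhds hs.1 hs.2] with u hu using hTe u (Set.Ioo_subset_Icc_self hu)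

/-- Distance to the first primary in terms of the regularizing coordinate `z`. -/
noncomputable def lcR (Y : Fin 8 → ℝ) : ℝ := (Y 0 ^ 2 + Y 1 ^ 2) / 2

/-- First coordinate relative to the first primary, `Re z ^ 2 / 2`. -/
noncomputable def lcX (Y : Fin 8 → ℝ) : ℝ := (Y 0 ^ 2 - Y 1 ^ 2) / 2

/-- Squared distance to the second primary. -/
noncomputable def lcD (Y : Fin 8 → ℝ) : ℝ := (lcX Y - 1) ^ 2 + (Y 0 * Y 1) ^ 2

/-- The energy coefficient of the regularized equations. -/
noncomputable def lcE (k : ℝ) (Y : Fin 8 → ℝ) : ℝ :=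
  Y 6 + Y 5 ^ 2 / 2 + Y 5 * (Y 4 - lcX Y + k)

/-- First component of the perturbing force. -/
noncomputable def lcF (k : ℝ) (Y : Fin 8 → ℝ) : ℝ := -Y 5 * ((lcX Y - 1) * k ^ 3 + 1)

/-- Second component of the perturbing force. -/
noncomputable def lcF' (k : ℝ) (Y : Fin 8 → ℝ) : ℝ := -Y 5 * (Y 0 * Y 1 * k ^ 3)

/-- The Levi-Civita regularized equations in rotating coordinates centred at the first primary; the
state is `(z, ζ, g, μ, h, t)` and `k` is the inverse distance to the second primary. -/
noncomputable def lcField (k : ℝ) (Y : Fin 8 → ℝ) : Fin 8 → ℝ :=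
  ![Y 2 + lcR Y / 2 * Y 1,
    Y 3 - lcR Y / 2 * Y 0,
    lcE k Y / 2 * Y 0 + lcR Y / 2 * (Y 0 * lcF k Y + Y 1 * lcF' k Y) + lcR Y / 2 * Y 3,
    lcE k Y / 2 * Y 1 + lcR Y / 2 * (Y 0 * lcF' k Y - Y 1 * lcF k Y) - lcR Y / 2 * Y 2,
    lcR Y * (Y 0 * Y 1) * (1 - k ^ 3),
    0, 0, lcR Y]

/-- Solutions of the regularized equations on `[0, S]` that avoid the second primary. -/
def IsLCSol (S : ℝ) (γ : ℝ → Fin 8 → ℝ) : Prop :=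
  ∀ s ∈ Set.Icc 0 S, 0 < lcD (γ s) ∧ HasDerivAt γ (lcField (√(lcD (γ s)))⁻¹ (γ s)) s

/-- First position coordinate of a regularized state. -/
noncomputable def lcQ1 (Y : Fin 8 → ℝ) : ℝ := lcX Y - Y 5

/-- Second position coordinate of a regularized state. -/
noncomputable def lcQ2 (Y : Fin 8 → ℝ) : ℝ := Y 0 * Y 1

/-- First momentum of a regularized state. -/
noncomputable def lcP1 (Y : Fin 8 → ℝ) : ℝ := (Y 0 * Y 2 - Y 1 * Y 3) / lcR Y

/-- Second momentum of a regularized state. -/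
noncomputable def lcP2 (Y : Fin 8 → ℝ) : ℝ := (Y 0 * Y 3 + Y 1 * Y 2) / lcR Y - Y 5

theorem eq_left_of_hasDerivAt_zero {S : ℝ} {f : ℝ → ℝ} (hf : ∀ s ∈ Set.Icc 0 S, HasDerivAt f 0 s)
    {s : ℝ} (hs : s ∈ Set.Icc 0 S) : f s = f 0 := by
  have := (convex_Icc 0 S).norm_image_sub_le_of_norm_hasDerivWithin_le (C := 0)
    (fun u hu => (hf u hu).hasDerivWithinAt) (fun u _ => by simp)
    (Set.left_mem_Icc.mpr (hs.1.trans hs.2)) hs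
  simpa [sub_eq_zero] using this

theorem lcS_dist {μ : ℝ} {Y : Fin 8 → ℝ} (h5 : Y 5 = μ) : dS μ (lcQ1 Y) (lcQ2 Y) = lcR Y := by
  have : (lcQ1 Y + μ) ^ 2 + lcQ2 Y ^ 2 = lcR Y ^ 2 := by
    simp only [lcQ1, lcQ2, lcR, lcX, h5]
    ring
  rw [dS, this, Real.sqrt_sq (by unfold lcR; positivity)]

theorem lcJ_dist {μ : ℝ} {Y : Fin 8 → ℝ} (h5 : Y 5 = μ) : dJ μ (lcQ1 Y) (lcQ2 Y) = √(lcD Y) := by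
  rw [dJ, lcD]
  congr 1
  simp only [lcQ1, lcQ2, h5]
  ring

theorem lc_momentum_aux {z z' w w' r E F F' : ℝ} (hr : 0 < r) (h : r = (z ^ 2 + z' ^ 2) / 2) :
    ((((w + r / 2 * z') * w + z * (E / 2 * z + r / 2 * (z * F + z' * F') + r / 2 * w')) -
      ((w' - r / 2 * z) * w' + z' * (E / 2 * z' + r / 2 * (z * F' - z' * F) - r / 2 * w))) * r -
      (z * w - z' * w') * (z * (w + r / 2 * z') + z' * (w' - r / 2 * z))) / r ^ 2 * r⁻¹ =
    (z * w' + z' * w) / r + F -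
      (w ^ 2 + w' ^ 2 - E * r) * ((z ^ 2 - z' ^ 2) / 2) / r ^ 3 := by
  field_simp
  rw [h]
  ring

theorem lc_momentum_aux' {z z' w w' r E F F' : ℝ} (hr : 0 < r) (h : r = (z ^ 2 + z' ^ 2) / 2) :
    ((((w + r / 2 * z') * w' + z * (E / 2 * z' + r / 2 * (z * F' - z' * F) - r / 2 * w)) +
      ((w' - r / 2 * z) * w + z' * (E / 2 * z + r / 2 * (z * F + z' * F') + r / 2 * w'))) * r -
      (z * w' + z' * w) * (z * (w + r / 2 * z') + z' * (w' - r / 2 * z))) / r ^ 2 * r⁻¹ =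
    -((z * w - z' * w') / r) + F' -
      (w ^ 2 + w' ^ 2 - E * r) * (z * z') / r ^ 3 := by
  field_simp
  rw [h]
  ring

theorem IsLCSol.hasDerivAt_apply
    {S : ℝ} {γ : ℝ → Fin 8 → ℝ} (hγ : IsLCSol S γ)
    {s : ℝ} (hs : s ∈ Set.Icc 0 S) :
    HasDerivAt (fun s => γ s 0) (γ s 2 + lcR (γ s) / 2 * γ s 1) s ∧
    HasDerivAt (fun s => γ s 1) (γ s 3 - lcR (γ s) / 2 * γ s 0) s ∧
    HasDerivAt (fun s => γ s 2) (lcE (√(lcD (γ s)))⁻¹ (γ s) / 2 * γ s 0 + lcR (γ s) / 2 *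
      (γ s 0 * lcF (√(lcD (γ s)))⁻¹ (γ s) + γ s 1 * lcF' (√(lcD (γ s)))⁻¹ (γ s)) +
      lcR (γ s) / 2 * γ s 3) s ∧
    HasDerivAt (fun s => γ s 3) (lcE (√(lcD (γ s)))⁻¹ (γ s) / 2 * γ s 1 + lcR (γ s) / 2 *
      (γ s 0 * lcF' (√(lcD (γ s)))⁻¹ (γ s) - γ s 1 * lcF (√(lcD (γ s)))⁻¹ (γ s)) -
      lcR (γ s) / 2 * γ s 2) s ∧
    HasDerivAt (fun s => γ s 4)
      (lcR (γ s) * (γ s 0 * γ s 1) * (1 - (√(lcD (γ s)))⁻¹ ^ 3)) s ∧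
    HasDerivAt (fun s => γ s 5) 0 s ∧ HasDerivAt (fun s => γ s 6) 0 s ∧
    HasDerivAt (fun s => γ s 7) (lcR (γ s)) s := by
  have d := fun i => hasDerivAt_pi.mp (hγ s hs).2 i
  exact ⟨d 0, d 1, d 2, d 3, d 4, d 5, d 6, d 7⟩

theorem IsLCSol.energy
    {S : ℝ} {γ : ℝ → Fin 8 → ℝ} (hγ : IsLCSol S γ)
    {s : ℝ} (hs : s ∈ Set.Icc 0 S) :
    γ s 2 ^ 2 + γ s 3 ^ 2 - lcE (√(lcD (γ s)))⁻¹ (γ s) * lcR (γ s) =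
      γ 0 2 ^ 2 + γ 0 3 ^ 2 - lcE (√(lcD (γ 0)))⁻¹ (γ 0) * lcR (γ 0) := by
  refine eq_left_of_hasDerivAt_zero (S := S) (f := fun s => γ s 2 ^ 2 + γ s 3 ^ 2 -
    lcE (√(lcD (γ s)))⁻¹ (γ s) * lcR (γ s)) (fun s hs => ?_) hs
  obtain ⟨d0, d1, d2, d3, d4, d5, d6, -⟩ := hγ.hasDerivAt_apply hs
  have hk : 0 < √(lcD (γ s)) := Real.sqrt_pos.mpr (hγ s hs).1
  have dX : HasDerivAt (fun s => lcX (γ s)) _ s := ((d0.pow 2).sub (d1.pow 2)).div_const 2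
  have dR : HasDerivAt (fun s => lcR (γ s)) _ s := ((d0.pow 2).add (d1.pow 2)).div_const 2
  have dk : HasDerivAt (fun s => (√(lcD (γ s)))⁻¹) _ s :=
    HasDerivAt.inv_sqrt_sum (dX.sub_const 1) (d0.mul d1) hk
  have dE : HasDerivAt (fun s => lcE (√(lcD (γ s)))⁻¹ (γ s)) _ s :=
    (d6.add ((d5.pow 2).div_const 2)).add (d5.mul ((d4.sub dX).add dk))
  refine (((d2.pow 2).add (d3.pow 2)).sub (dE.mul dR)).congr_deriv ?_
  have ek : √((lcX (γ s) - 1) ^ 2 + (γ s 0 * γ s 1) ^ 2) =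
    ((√(lcD (γ s)))⁻¹)⁻¹ := (inv_inv _).symm
  rw [ek]
  generalize (√(lcD (γ s)))⁻¹ = k
  simp only [div_eq_mul_inv, inv_pow, inv_inv, Nat.cast_ofNat, lcE, lcF, lcF', lcX, lcR]
  ring

theorem IsLCSol.angMom
    {S : ℝ} {γ : ℝ → Fin 8 → ℝ} (hγ : IsLCSol S γ)
    {s : ℝ} (hs : s ∈ Set.Icc 0 S) :
    γ s 0 * γ s 3 - γ s 1 * γ s 2 - γ s 5 * γ s 4 =
      γ 0 0 * γ 0 3 - γ 0 1 * γ 0 2 - γ 0 5 * γ 0 4 := by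
  refine eq_left_of_hasDerivAt_zero (S := S) (f := fun s => γ s 0 * γ s 3 - γ s 1 * γ s 2 -
    γ s 5 * γ s 4) (fun s hs => ?_) hs
  obtain ⟨d0, d1, d2, d3, d4, d5, d6, -⟩ := hγ.hasDerivAt_apply hs
  refine (((d0.mul d3).sub (d1.mul d2)).sub (d5.mul d4)).congr_deriv ?_
  generalize (√(lcD (γ s)))⁻¹ = k
  simp only [lcE, lcF, lcF', lcX, lcR]
  ring

/-- Initial data of ejection orbits with mass ratio `μ` and energy `h`. -/
def IsLCEjection (μ h : ℝ) (Y : Fin 8 → ℝ) : Prop :=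
  Y 0 = 0 ∧ Y 1 = 0 ∧ Y 2 ^ 2 + Y 3 ^ 2 = 1 - μ ∧ Y 4 = 0 ∧ Y 5 = μ ∧ Y 6 = h ∧ Y 7 = 0

theorem IsLCSol.integrals
    {S : ℝ} {γ : ℝ → Fin 8 → ℝ} (hγ : IsLCSol S γ)
    {μ h : ℝ} (h0 : IsLCEjection μ h (γ 0))
    {s : ℝ} (hs : s ∈ Set.Icc 0 S) :
    γ s 5 = μ ∧ γ s 6 = h ∧
      γ s 2 ^ 2 + γ s 3 ^ 2 = 1 - μ + lcE (√(lcD (γ s)))⁻¹ (γ s) * lcR (γ s) ∧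
      γ s 0 * γ s 3 - γ s 1 * γ s 2 = μ * γ s 4 := by
  obtain ⟨i0, i1, i2, i4, i5, i6, -⟩ := h0
  have e5 : γ s 5 = μ := by
    rw [← i5]
    exact eq_left_of_hasDerivAt_zero (fun s hs => (hγ.hasDerivAt_apply hs).2.2.2.2.2.1) hs
  have e6 : γ s 6 = h := by
    rw [← i6]
    exact eq_left_of_hasDerivAt_zero (fun s hs => (hγ.hasDerivAt_apply hs).2.2.2.2.2.2.1) hs
  have hr : lcR (γ 0) = 0 := by simp [lcR, i0, i1]
  have e := hγ.energy hs
  have a := hγ.angMom hs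
  rw [i2, hr] at e
  rw [i0, i1, i4, e5] at a
  exact ⟨e5, e6, by linarith, by linarith⟩

theorem IsLCSol.ham_eq
    {S : ℝ} {γ : ℝ → Fin 8 → ℝ} (hγ : IsLCSol S γ)
    {μ h : ℝ} (h0 : IsLCEjection μ h (γ 0))
    {s : ℝ} (hs : s ∈ Set.Icc 0 S) (hr : 0 < lcR (γ s)) :
    Ham μ (lcQ1 (γ s)) (lcQ2 (γ s)) (lcP1 (γ s)) (lcP2 (γ s)) = h := by
  obtain ⟨e5, e6, e, a⟩ := hγ.integrals h0 hs
  rw [Ham, lcS_dist e5, lcJ_dist e5, div_eq_mul_inv μ]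
  generalize (√(lcD (γ s)))⁻¹ = k at e ⊢
  have hE : (γ s 2 ^ 2 + γ s 3 ^ 2) / lcR (γ s) = (1 - μ) / lcR (γ s) + lcE k (γ s) := by
    rw [e]; field_simp
  have hP : (γ s 0 * γ s 2 - γ s 1 * γ s 3) ^ 2 + (γ s 0 * γ s 3 + γ s 1 * γ s 2) ^ 2 =
      2 * lcR (γ s) * (γ s 2 ^ 2 + γ s 3 ^ 2) := by unfold lcR; ring
  have hA : lcX (γ s) * (γ s 0 * γ s 3 + γ s 1 * γ s 2) -
      γ s 0 * γ s 1 * (γ s 0 * γ s 2 - γ s 1 * γ s 3) = lcR (γ s) * (μ * γ s 4) := by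
    rw [← a]; unfold lcR lcX; ring
  have hE' : lcE k (γ s) = h + μ ^ 2 / 2 + μ * (γ s 4 - lcX (γ s) + k) := by rw [lcE, e5, e6]
  simp only [lcQ1, lcQ2, lcP1, lcP2, e5]
  generalize lcX (γ s) = x at *
  generalize lcR (γ s) = r at *
  generalize γ s 0 * γ s 1 = x' at *
  generalize γ s 0 * γ s 2 - γ s 1 * γ s 3 = A at *
  generalize γ s 0 * γ s 3 + γ s 1 * γ s 2 = A' at *
  generalize γ s 2 ^ 2 + γ s 3 ^ 2 = W at *
  have hP' : (A / r) ^ 2 + (A' / r) ^ 2 = 2 * (W / r) := by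
    field_simp
    linear_combination hP
  have hA' : x * (A' / r) - x' * (A / r) = μ * γ s 4 := by
    field_simp
    linear_combination hA
  linear_combination hP' / 2 + hE - hA' + hE'

theorem IsLCSol.exists_solution
    {S : ℝ} {γ : ℝ → Fin 8 → ℝ} (hγ : IsLCSol S γ)
    {μ h : ℝ} (h0 : IsLCEjection μ h (γ 0))
    (hr : ∀ s ∈ Set.Ioo 0 S, 0 < lcR (γ s)) {s₁ : ℝ}
    (hs₁ : s₁ ∈ Set.Ioo 0 S) :
    ∃ t₁, 0 < t₁ ∧ ∃ q1 q2 p1 p2 : ℝ → ℝ, IsPCRTBPSol μ (Set.Ioc 0 t₁) q1 q2 p1 p2 ∧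
      Tendsto (fun t => (q1 t, q2 t)) (𝓝[>] 0) (𝓝 (-μ, 0)) ∧ q1 t₁ = lcQ1 (γ s₁) ∧
      q2 t₁ = lcQ2 (γ s₁) ∧ p1 t₁ = lcP1 (γ s₁) ∧ p2 t₁ = lcP2 (γ s₁) := by
  have d := fun s hs => hγ.hasDerivAt_apply (s := s) hs
  obtain ⟨σ, hσc, hσ, hσd⟩ := exists_inverse_time (hs₁.1.trans hs₁.2).le
    (fun s hs => (d s hs).2.2.2.2.2.2.2) hr
  have hτc : ContinuousOn (fun s => γ s 7) (Set.Icc 0 S) := fun s hs =>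
    (d s hs).2.2.2.2.2.2.2.continuousAt.continuousWithinAt
  have hτm : StrictMonoOn (fun s => γ s 7) (Set.Icc 0 S) := by
    refine strictMonoOn_of_deriv_pos (convex_Icc 0 S) hτc fun s hs => ?_
    rw [interior_Icc] at hs
    rw [(d s (Set.Ioo_subset_Icc_self hs)).2.2.2.2.2.2.2.deriv]
    exact hr s hs
  have h0I : (0 : ℝ) ∈ Set.Icc 0 S := ⟨le_rfl, (hs₁.1.trans hs₁.2).le⟩
  have hs₁I := Set.Ioo_subset_Icc_self hs₁
  have ht₁ : 0 < γ s₁ 7 := by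
    have := hτm h0I hs₁I hs₁.1
    simp only [h0.2.2.2.2.2.2] at this
    exact this
  have hσ0 : σ 0 = 0 := by
    have := hσ 0 h0I
    rwa [h0.2.2.2.2.2.2] at this
  refine ⟨γ s₁ 7, ht₁, fun t => lcQ1 (γ (σ t)), fun t => lcQ2 (γ (σ t)),
    fun t => lcP1 (γ (σ t)), fun t => lcP2 (γ (σ t)), ?_, ?_, ?_⟩
  · intro t ht
    obtain ⟨s, hs, rfl⟩ : ∃ s ∈ Set.Ioo 0 S, γ s 7 = t := by
      have ht' : t ∈ Set.Icc (γ 0 7) (γ s₁ 7) := by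
        rw [h0.2.2.2.2.2.2]; exact ⟨ht.1.le, ht.2⟩
      obtain ⟨s, hs, hst⟩ := intermediate_value_Icc hs₁.1.le
        (hτc.mono (Set.Icc_subset_Icc_right hs₁.2.le)) ht'
      refine ⟨s, ⟨lt_of_le_of_ne hs.1 fun h => ?_, hs.2.trans_lt hs₁.2⟩, hst⟩
      rw [← h] at hst
      simp only [h0.2.2.2.2.2.2] at hst
      exact ht.1.ne hst
    have hsI := Set.Ioo_subset_Icc_self hs
    have hrs := hr s hs
    obtain ⟨d0, d1, d2, d3, -, d5, -, -⟩ := d s hsI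
    obtain ⟨e5, e6, e, a⟩ := hγ.integrals h0 hsI
    have hk : 0 < √(lcD (γ s)) := Real.sqrt_pos.mpr (hγ s hsI).1
    have hSd := lcS_dist (Y := γ s) e5
    have hJd := lcJ_dist (Y := γ s) e5
    have dX : HasDerivAt (fun s => lcX (γ s)) _ s := ((d0.pow 2).sub (d1.pow 2)).div_const 2
    have dR : HasDerivAt (fun s => lcR (γ s)) _ s := ((d0.pow 2).add (d1.pow 2)).div_const 2
    have dσ := hσd s hs
    have hσs := hσ s hsI
    have comp : ∀ {f : ℝ → ℝ} {f' : ℝ}, HasDerivAt f f' s →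
        HasDerivAt (fun t => f (σ t)) (f' * (lcR (γ s))⁻¹) (γ s 7) := fun {f f'} hf => by
      rw [← hσs] at hf
      exact hf.comp _ dσ
    simp only [hσs]
    rw [hSd, hJd]
    have hR : γ s 0 ^ 2 = 2 * lcR (γ s) - γ s 1 ^ 2 := by unfold lcR; ring
    have hX : lcX (γ s) = lcR (γ s) - γ s 1 ^ 2 := by unfold lcX lcR; ring
    refine ⟨⟨fun hh => ?_, fun hh => ?_⟩, ?_, ?_, ?_, ?_⟩
    · rw [Prod.mk.injEq] at hh
      rw [hh.1, hh.2] at hSd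
      simp [dS] at hSd
      exact hrs.ne hSd
    · rw [Prod.mk.injEq] at hh
      rw [hh.1, hh.2] at hJd
      simp [dJ] at hJd
      exact hk.ne hJd
    · refine (comp (dX.sub d5)).congr_deriv ?_
      simp only [lcP1, lcQ2]
      field_simp
      ring
    · refine (comp (d0.mul d1)).congr_deriv ?_
      simp only [lcP2, lcQ1, e5]
      have hx : lcX (γ s) = (γ s 0 ^ 2 - γ s 1 ^ 2) / 2 := rfl
      rw [hx]
      field_simp
      ring
    · refine (comp (((d0.mul d2).sub (d1.mul d3)).div dR hrs.ne')).congr_deriv ?_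
      have aux := lc_momentum_aux (w := γ s 2) (w' := γ s 3) (E := lcE (√(lcD (γ s)))⁻¹ (γ s))
        (F := lcF (√(lcD (γ s)))⁻¹ (γ s)) (F' := lcF' (√(lcD (γ s)))⁻¹ (γ s)) hrs rfl
      refine Eq.trans ?_ (aux.trans ?_)
      · simp only [Pi.sub_apply, Pi.mul_apply]
        ring
      · rw [e]
        simp only [lcP2, lcQ1, lcF, lcX, e5]
        field_simp
        ring
    · refine (comp ((((d0.mul d3).add (d1.mul d2)).div dR hrs.ne').sub d5)).congr_deriv ?_
      have aux := lc_momentum_aux' (w := γ s 2) (w' := γ s 3) (E := lcE (√(lcD (γ s)))⁻¹ (γ s))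
        (F := lcF (√(lcD (γ s)))⁻¹ (γ s)) (F' := lcF' (√(lcD (γ s)))⁻¹ (γ s)) hrs rfl
      refine Eq.trans ?_ (aux.trans ?_)
      · simp only [Pi.add_apply, Pi.mul_apply]
        ring
      · rw [e]
        simp only [lcP1, lcQ2, lcF', e5]
        field_simp
        ring
  · have c : ∀ i, ContinuousWithinAt (fun t => γ (σ t) i) (Set.Ioi 0) 0 := fun i => by
      have h1 : ContinuousAt (fun s => γ s i) (σ 0) := by
        rw [hσ0]
        exact (hasDerivAt_pi.mp (hγ 0 h0I).2 i).continuousAt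
      exact (h1.comp hσc.continuousAt).continuousWithinAt
    have c0 := (c 0).tendsto
    have c1 := (c 1).tendsto
    have c5 := (c 5).tendsto
    rw [hσ0, h0.1] at c0
    rw [hσ0, h0.2.1] at c1
    rw [hσ0, h0.2.2.2.2.1] at c5
    have l1 := (((c0.pow 2).sub (c1.pow 2)).div_const 2).sub c5
    have l2 := c0.mul c1
    norm_num at l1 l2
    exact l1.prodMk_nhds l2
  · simp only [hσ s₁ hs₁I, and_self]

/-- Clamping all coordinates of a state. -/
noncomputable def clampState (N : ℝ) (Y : Fin 8 → ℝ) : Fin 8 → ℝ := fun i => clampTo N (Y i)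

/-- Bounded Lipschitz truncation of `lcField`. -/
noncomputable def lcTrunc (N ε : ℝ) (Y : Fin 8 → ℝ) : Fin 8 → ℝ :=
  lcField (√(max (lcD (clampState N Y)) ε))⁻¹ (clampState N Y)

theorem clampState_eq {N : ℝ} {Y : Fin 8 → ℝ} (h : ∀ i, |Y i| ≤ N) : clampState N Y = Y :=
  funext fun i => clampTo_eq (h i)

theorem bddLip_lcD {N : ℝ} (hN : 0 ≤ N) : BddLip fun Y => lcD (clampState N Y) := by
  have c := fun i => BddLip.clamp_coord (ι := Fin 8) hN i
  exact (((((c 0).pow 2).sub ((c 1).pow 2)).div_const 2).sub (.const 1)).pow 2 |>.add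
    (((c 0).mul (c 1)).pow 2)

theorem bddLip_lcTrunc {N ε : ℝ} (hN : 0 ≤ N) (hε : 0 < ε) (i : Fin 8) :
    BddLip fun Y => lcTrunc N ε Y i := by
  have c := fun i => BddLip.clamp_coord (ι := Fin 8) hN i
  have hk : BddLip fun Y => (√(max (lcD (clampState N Y)) ε))⁻¹ :=
    (((bddLip_lcD hN).max_const ε).sqrt hε fun Y => le_max_right _ _).inv (sqrt_pos.mpr hε)
      fun Y => sqrt_le_sqrt (le_max_right _ _)
  have hR : BddLip fun Y => lcR (clampState N Y) := (((c 0).pow 2).add ((c 1).pow 2)).div_const 2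
  have hX : BddLip fun Y => lcX (clampState N Y) := (((c 0).pow 2).sub ((c 1).pow 2)).div_const 2
  have hE : BddLip fun Y => lcE (√(max (lcD (clampState N Y)) ε))⁻¹ (clampState N Y) :=
    ((c 6).add (((c 5).pow 2).div_const 2)).add ((c 5).mul (((c 4).sub hX).add hk))
  have hF : BddLip fun Y => lcF (√(max (lcD (clampState N Y)) ε))⁻¹ (clampState N Y) :=
    (c 5).neg.mul (((hX.sub (.const 1)).mul (hk.pow 3)).add (.const 1))
  have hF' : BddLip fun Y => lcF' (√(max (lcD (clampState N Y)) ε))⁻¹ (clampState N Y) :=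
    (c 5).neg.mul (((c 0).mul (c 1)).mul (hk.pow 3))
  have hR2 := hR.div_const 2
  have hE2 := hE.div_const 2
  fin_cases i
  · exact (c 2).add (hR2.mul (c 1))
  · exact (c 3).sub (hR2.mul (c 0))
  · exact ((hE2.mul (c 0)).add (hR2.mul (((c 0).mul hF).add ((c 1).mul hF')))).add (hR2.mul (c 3))
  · exact ((hE2.mul (c 1)).add (hR2.mul (((c 0).mul hF').sub ((c 1).mul hF)))).sub (hR2.mul (c 2))
  · exact (hR.mul ((c 0).mul (c 1))).mul ((BddLip.const 1).sub (hk.pow 3))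
  · exact BddLip.const 0
  · exact BddLip.const 0
  · exact hR

/-- Squared distance to the (massless) second primary along the unperturbed ejection orbit. -/
noncomputable def unpD (θ s : ℝ) : ℝ := 1 + s ^ 4 / 4 - s ^ 2 * cos (θ - s ^ 3 / 6)

/-- Rate of change of the angular momentum per unit of perturbing mass. -/
noncomputable def unpRate (ε θ s : ℝ) : ℝ :=
  s ^ 4 / 4 * sin (θ - s ^ 3 / 6) * (1 - (√(max (unpD θ s) ε))⁻¹ ^ 3)

/-- The unperturbed ejection orbit. -/
noncomputable def unpOrbit (ε θ s : ℝ) : Fin 8 → ℝ :=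
  ![s * cos (θ / 2 - s ^ 3 / 12), s * sin (θ / 2 - s ^ 3 / 12), cos (θ / 2 - s ^ 3 / 12),
    sin (θ / 2 - s ^ 3 / 12), ∫ u in (0 : ℝ)..s, unpRate ε θ u, 0, 0, s ^ 3 / 6]

theorem continuous_unpRate {ε : ℝ} (hε : 0 < ε) (θ : ℝ) : Continuous (unpRate ε θ) := by
  have h : ∀ s, √(max (unpD θ s) ε) ≠ 0 := fun s =>
    (sqrt_pos.mpr (lt_max_of_lt_right hε)).ne'
  unfold unpRate
  refine Continuous.mul (by fun_prop) (continuous_const.sub ((Continuous.inv₀ ?_ h).pow 3))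
  unfold unpD
  fun_prop

theorem abs_unpRate_le {ε : ℝ} (hε : 0 < ε) (θ : ℝ) {s : ℝ} (hs : s ∈ Set.Icc (0 : ℝ) 4) :
    |unpRate ε θ s| ≤ 64 * (1 + (√ε)⁻¹ ^ 3) := by
  have h1 : (√(max (unpD θ s) ε))⁻¹ ≤ (√ε)⁻¹ :=
    inv_anti₀ (sqrt_pos.mpr hε) (sqrt_le_sqrt (le_max_right _ _))
  have h2 : 0 ≤ (√(max (unpD θ s) ε))⁻¹ := by positivity
  have h3 := pow_le_pow_left₀ h2 h1 3
  have h4 : (0 : ℝ) ≤ (√(max (unpD θ s) ε))⁻¹ ^ 3 := by positivity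
  have h5 : s ^ 4 / 4 ≤ 64 := by
    have := pow_le_pow_left₀ hs.1 hs.2 4
    linarith
  rw [unpRate, abs_mul, abs_mul, abs_of_nonneg (by positivity : 0 ≤ s ^ 4 / 4)]
  have h6 := abs_sin_le_one (θ - s ^ 3 / 6)
  have h7 : |1 - (√(max (unpD θ s) ε))⁻¹ ^ 3| ≤ 1 + (√ε)⁻¹ ^ 3 := by
    rw [abs_le]; constructor <;> linarith
  calc _ ≤ 64 * 1 * (1 + (√ε)⁻¹ ^ 3) := by gcongr
    _ = _ := by ring

theorem abs_unpOrbit_le {ε : ℝ} (hε : 0 < ε) (θ : ℝ) {s : ℝ} (hs : s ∈ Set.Icc (0 : ℝ) 4)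
    (i : Fin 8) : |unpOrbit ε θ s i| ≤ 256 * (1 + (√ε)⁻¹ ^ 3) := by
  have hp : 0 ≤ (√ε)⁻¹ ^ 3 := by positivity
  have hs0 := hs.1
  have hs4 := hs.2
  have c := abs_cos_le_one (θ / 2 - s ^ 3 / 12)
  have d := abs_sin_le_one (θ / 2 - s ^ 3 / 12)
  fin_cases i
  · change |s * cos (θ / 2 - s ^ 3 / 12)| ≤ _
    rw [abs_mul, abs_of_nonneg hs0]
    nlinarith [abs_nonneg (cos (θ / 2 - s ^ 3 / 12))]
  · change |s * sin (θ / 2 - s ^ 3 / 12)| ≤ _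
    rw [abs_mul, abs_of_nonneg hs0]
    nlinarith [abs_nonneg (sin (θ / 2 - s ^ 3 / 12))]
  · exact c.trans (by linarith)
  · exact d.trans (by linarith)
  · have := intervalIntegral.norm_integral_le_of_norm_le_const (a := 0) (b := s)
      (f := unpRate ε θ) (C := 64 * (1 + (√ε)⁻¹ ^ 3)) fun u hu => by
        rw [Set.uIoc_of_le hs0] at hu
        exact abs_unpRate_le hε θ ⟨hu.1.le, hu.2.trans hs4⟩
    rw [sub_zero, abs_of_nonneg hs0, Real.norm_eq_abs] at this
    change |∫ u in (0 : ℝ)..s, unpRate ε θ u| ≤ _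
    nlinarith
  · change |(0 : ℝ)| ≤ _
    rw [abs_zero]; positivity
  · change |(0 : ℝ)| ≤ _
    rw [abs_zero]; positivity
  · change |s ^ 3 / 6| ≤ _
    rw [abs_of_nonneg (by positivity)]
    have := pow_le_pow_left₀ hs0 hs4 3
    linarith

theorem lcD_unpOrbit (ε θ s : ℝ) : lcD (unpOrbit ε θ s) = unpD θ s := by
  have h : θ - s ^ 3 / 6 = 2 * (θ / 2 - s ^ 3 / 12) := by ring
  have h1 := sin_sq_add_cos_sq (θ / 2 - s ^ 3 / 12)
  rw [unpD, h, cos_two_mul]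
  change ((((s * cos (θ / 2 - s ^ 3 / 12)) ^ 2 - (s * sin (θ / 2 - s ^ 3 / 12)) ^ 2) / 2 - 1) ^ 2 +
    (s * cos (θ / 2 - s ^ 3 / 12) * (s * sin (θ / 2 - s ^ 3 / 12))) ^ 2) = _
  rw [mul_pow s (sin _), sin_sq]
  have h2 : (s * cos (θ / 2 - s ^ 3 / 12) * (s * sin (θ / 2 - s ^ 3 / 12))) ^ 2 =
    s ^ 4 * cos (θ / 2 - s ^ 3 / 12) ^ 2 * (1 - cos (θ / 2 - s ^ 3 / 12) ^ 2) := by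
    rw [← sin_sq]; ring
  rw [h2]; ring

theorem hasDerivAt_unpOrbit {ε : ℝ} (hε : 0 < ε) (θ : ℝ) {s : ℝ} {N : ℝ}
    (hN : ∀ i, |unpOrbit ε θ s i| ≤ N) :
    HasDerivAt (unpOrbit ε θ) (lcTrunc N ε (unpOrbit ε θ s)) s := by
  have hp : HasDerivAt (fun s : ℝ => θ / 2 - s ^ 3 / 12) (-(s ^ 2 / 4)) s := by
    have := ((hasDerivAt_pow 3 s).div_const 12).const_sub (θ / 2)
    refine this.congr_deriv ?_
    norm_num
    ring
  have hc := hp.cos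
  have hs := hp.sin
  have h1 := sin_sq_add_cos_sq (θ / 2 - s ^ 3 / 12)
  have hR : lcR (unpOrbit ε θ s) = s ^ 2 / 2 := by
    change ((s * cos (θ / 2 - s ^ 3 / 12)) ^ 2 + (s * sin (θ / 2 - s ^ 3 / 12)) ^ 2) / 2 = _
    linear_combination s ^ 2 / 2 * h1
  rw [lcTrunc, clampState_eq hN, lcD_unpOrbit, hasDerivAt_pi]
  intro i
  set k := (√(max (unpD θ s) ε))⁻¹
  have hE : lcE k (unpOrbit ε θ s) = 0 := by
    change (0 : ℝ) + 0 ^ 2 / 2 + 0 * _ = 0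
    ring
  have hF : lcF k (unpOrbit ε θ s) = 0 := by
    change -(0 : ℝ) * _ = 0
    ring
  have hF' : lcF' k (unpOrbit ε θ s) = 0 := by
    change -(0 : ℝ) * _ = 0
    ring
  simp only [lcField, hE, hF, hF', hR]
  fin_cases i
  · refine ((hasDerivAt_id s).mul hc).congr_deriv ?_
    change 1 * cos (θ / 2 - s ^ 3 / 12) + s * (-sin (θ / 2 - s ^ 3 / 12) * -(s ^ 2 / 4)) =
      cos (θ / 2 - s ^ 3 / 12) + s ^ 2 / 2 / 2 * (s * sin (θ / 2 - s ^ 3 / 12))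
    ring
  · refine ((hasDerivAt_id s).mul hs).congr_deriv ?_
    change 1 * sin (θ / 2 - s ^ 3 / 12) + s * (cos (θ / 2 - s ^ 3 / 12) * -(s ^ 2 / 4)) =
      sin (θ / 2 - s ^ 3 / 12) - s ^ 2 / 2 / 2 * (s * cos (θ / 2 - s ^ 3 / 12))
    ring
  · refine hc.congr_deriv ?_
    change _ = 0 / 2 * _ + s ^ 2 / 2 / 2 * (_ * 0 + _ * 0) +
      s ^ 2 / 2 / 2 * sin (θ / 2 - s ^ 3 / 12)
    ring
  · refine hs.congr_deriv ?_
    change _ = 0 / 2 * _ + s ^ 2 / 2 / 2 * (_ * 0 - _ * 0) -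
      s ^ 2 / 2 / 2 * cos (θ / 2 - s ^ 3 / 12)
    ring
  · refine (intervalIntegral.integral_hasDerivAt_right
      ((continuous_unpRate hε θ).intervalIntegrable _ _)
      ((continuous_unpRate hε θ).stronglyMeasurableAtFilter _ _)
      (continuous_unpRate hε θ).continuousAt).congr_deriv ?_
    have h : θ - s ^ 3 / 6 = 2 * (θ / 2 - s ^ 3 / 12) := by ring
    change s ^ 4 / 4 * sin (θ - s ^ 3 / 6) * (1 - k ^ 3) = s ^ 2 / 2 *
      (s * cos (θ / 2 - s ^ 3 / 12) * (s * sin (θ / 2 - s ^ 3 / 12))) * (1 - k ^ 3)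
    rw [h, sin_two_mul]
    ring
  · exact hasDerivAt_const _ _
  · exact hasDerivAt_const _ _
  · refine ((hasDerivAt_pow 3 s).div_const 6).congr_deriv ?_
    change _ = s ^ 2 / 2
    norm_num
    ring

/-- Initial condition of the perturbed ejection orbit with asymptotic direction `θ`. -/
noncomputable def ejectState (μ h θ : ℝ) : Fin 8 → ℝ :=
  ![0, 0, √(1 - μ) * cos (θ / 2), √(1 - μ) * sin (θ / 2), 0, μ, h, 0]

theorem isLCEjection_ejectState {μ h θ : ℝ} (hμ : μ ≤ 1) :
    IsLCEjection μ h (ejectState μ h θ) := by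
  refine ⟨rfl, rfl, ?_, rfl, rfl, rfl, rfl⟩
  change (√(1 - μ) * cos (θ / 2)) ^ 2 + (√(1 - μ) * sin (θ / 2)) ^ 2 = 1 - μ
  have := sq_sqrt (sub_nonneg.mpr hμ)
  linear_combination (√(1 - μ)) ^ 2 * sin_sq_add_cos_sq (θ / 2) + this

theorem dist_ejectState_le {μ h θ ε : ℝ} (hμ0 : 0 ≤ μ) (hμ : μ ≤ 1) (hh : |h| ≤ μ) :
    dist (ejectState μ h θ) (unpOrbit ε θ 0) ≤ μ := by
  have h1 : |√(1 - μ) - 1| ≤ μ := by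
    have h2 := sq_sqrt (sub_nonneg.mpr hμ)
    have h3 := sqrt_nonneg (1 - μ)
    rw [abs_le]; constructor <;> nlinarith
  have h0 : θ / 2 - (0 : ℝ) ^ 3 / 12 = θ / 2 := by ring
  refine (dist_pi_le_iff hμ0).mpr fun i => ?_
  rw [Real.dist_eq]
  fin_cases i
  · change |0 - 0 * _| ≤ μ
    simpa using hμ0
  · change |0 - 0 * _| ≤ μ
    simpa using hμ0
  · change |√(1 - μ) * cos (θ / 2) - cos (θ / 2 - (0 : ℝ) ^ 3 / 12)| ≤ μ
    rw [h0, ← sub_one_mul, abs_mul]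
    exact (mul_le_of_le_one_right (abs_nonneg _) (abs_cos_le_one _)).trans h1
  · change |√(1 - μ) * sin (θ / 2) - sin (θ / 2 - (0 : ℝ) ^ 3 / 12)| ≤ μ
    rw [h0, ← sub_one_mul, abs_mul]
    exact (mul_le_of_le_one_right (abs_nonneg _) (abs_sin_le_one _)).trans h1
  · change |0 - ∫ u in (0 : ℝ)..0, unpRate ε θ u| ≤ μ
    simpa using hμ0
  · change |μ - 0| ≤ μ
    rw [sub_zero, abs_of_nonneg hμ0]
  · change |h - 0| ≤ μ
    rwa [sub_zero]
  · change |0 - (0 : ℝ) ^ 3 / 6| ≤ μ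
    simpa using hμ0

/-- Ejection orbits of the perturbed problem stay close to the unperturbed ones. -/
theorem exists_ejection_family {a b ε : ℝ} (hε : 0 < ε)
    (hD : ∀ θ ∈ Set.Icc a b, ∀ s ∈ Set.Icc (0 : ℝ) 4, 2 * ε ≤ unpD θ s) :
    ∃ μ₀ C : ℝ, 0 < μ₀ ∧ 0 ≤ C ∧ ∀ μ h : ℝ, 0 < μ → μ < μ₀ → |h| < μ →
      ∃ Γ : ℝ → ℝ → Fin 8 → ℝ, Continuous (fun θ => Γ θ 3) ∧ ∀ θ ∈ Set.Icc a b,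
        IsLCSol 4 (Γ θ) ∧ IsLCEjection μ h (Γ θ 0) ∧ (∀ s ∈ Set.Ioo (0 : ℝ) 4, 0 < lcR (Γ θ s)) ∧
        ∀ i, |Γ θ 3 i - unpOrbit ε θ 3 i| ≤ C * μ := by
  set N : ℝ := 256 * (1 + (√ε)⁻¹ ^ 3) + 1 with hNdef
  have hN : 0 ≤ N := by positivity
  obtain ⟨Φ, K, hK, hΦ0, hΦ⟩ := exists_flow_of_bddLip (f := lcTrunc N ε) (bddLip_lcTrunc hN hε)
  obtain ⟨L, hL, -, hLD⟩ := bddLip_lcD hN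
  set C : ℝ := exp (K * 4) with hC
  have hCp : 0 < C := exp_pos _
  have hKp : (0 : ℝ) ≤ K := K.2
  refine ⟨min 1 (min (1 / C) (min (ε / (L * C + 1)) (1 / (2 * (K * C + 1))))), C, by positivity,
    hCp.le, fun μ h hμ0 hμ hh => ?_⟩
  simp only [lt_min_iff] at hμ
  obtain ⟨m1, m2, m3, m4⟩ := hμ
  rw [lt_div_iff₀ (by positivity)] at m2 m3 m4
  refine ⟨fun θ => Φ (ejectState μ h θ), ?_, fun θ hθ => ?_⟩
  · have h1 : Continuous fun x => Φ x 3 := by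
      refine (LipschitzWith.of_dist_le_mul (K := ⟨exp (K * 3), (exp_pos _).le⟩) fun x y => ?_).continuous
      have := dist_flow_le hK (T := 3) (fun t _ => hΦ x t) (fun t _ => hΦ y t) 3 ⟨by norm_num, le_rfl⟩
      rw [hΦ0, hΦ0, mul_comm] at this
      exact this
    refine h1.comp (continuous_pi fun i => ?_)
    fin_cases i
    · exact continuous_const
    · exact continuous_const
    · change Continuous fun θ => √(1 - μ) * cos (θ / 2)
      fun_prop
    · change Continuous fun θ => √(1 - μ) * sin (θ / 2)
      fun_prop
    all_goals exact continuous_const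
  set γ := Φ (ejectState μ h θ) with hγ
  have hγ0 : γ 0 = ejectState μ h θ := hΦ0 _
  have hU : ∀ s ∈ Set.Icc (0 : ℝ) 4,
      HasDerivAt (unpOrbit ε θ) (lcTrunc N ε (unpOrbit ε θ s)) s := fun s hs =>
    hasDerivAt_unpOrbit hε θ fun i => (abs_unpOrbit_le hε θ hs i).trans (by linarith)
  have hdist : ∀ s ∈ Set.Icc (0 : ℝ) 4, dist (γ s) (unpOrbit ε θ s) ≤ C * μ := fun s hs => by
    refine (dist_flow_le hK (fun t _ => hΦ (ejectState μ h θ) t) hU s hs).trans ?_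
    rw [hΦ0, mul_comm C]
    exact mul_le_mul (dist_ejectState_le hμ0.le m1.le hh.le)
      (exp_le_exp.mpr (mul_le_mul_of_nonneg_left hs.2 hKp)) (exp_pos _).le hμ0.le
  have hi : ∀ s ∈ Set.Icc (0 : ℝ) 4, ∀ i, |γ s i - unpOrbit ε θ s i| ≤ C * μ := fun s hs i => by
    rw [← Real.dist_eq]
    exact (dist_le_pi_dist _ _ i).trans (hdist s hs)
  have hγN : ∀ s ∈ Set.Icc (0 : ℝ) 4, ∀ i, |γ s i| ≤ N := fun s hs i => by
    have h1 := hi s hs i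
    have h2 := abs_unpOrbit_le hε θ hs i
    have h3 := abs_sub_abs_le_abs_sub (γ s i) (unpOrbit ε θ s i)
    linarith
  have hUN : ∀ s ∈ Set.Icc (0 : ℝ) 4, ∀ i, |unpOrbit ε θ s i| ≤ N := fun s hs i => by
    have h2 := abs_unpOrbit_le hε θ hs i
    linarith
  have hγD : ∀ s ∈ Set.Icc (0 : ℝ) 4, ε ≤ lcD (γ s) := fun s hs => by
    have h1 := hLD (γ s) (unpOrbit ε θ s)
    beta_reduce at h1
    rw [clampState_eq (hγN s hs), clampState_eq (hUN s hs), lcD_unpOrbit] at h1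
    have h2 := hD θ hθ s hs
    have h3 := (abs_le.mp h1).1
    have h4 : L * dist (γ s) (unpOrbit ε θ s) ≤ L * (C * μ) := by gcongr; exact hdist s hs
    nlinarith
  refine ⟨fun s hs => ⟨hε.trans_le (hγD s hs), ?_⟩, ?_, fun s hs => ?_,
    hi 3 ⟨by norm_num, by norm_num⟩⟩
  · have := hΦ (ejectState μ h θ) s
    rwa [lcTrunc, ← hγ, clampState_eq (hγN s hs), max_eq_left (hγD s hs)] at this
  · change IsLCEjection μ h (γ 0)
    rw [hγ0]
    exact isLCEjection_ejectState m1.le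
  · have hs' := Set.Ioo_subset_Icc_self hs
    have key : ∀ i, γ 0 i = unpOrbit ε θ 0 i → |γ s i - unpOrbit ε θ s i| ≤ K * C * μ * s := by
      intro i h0
      have := (convex_Icc (0 : ℝ) 4).norm_image_sub_le_of_norm_hasDerivWithin_le
        (f := fun s => γ s i - unpOrbit ε θ s i) (C := K * C * μ)
        (fun u hu => (((hasDerivAt_pi.mp (hΦ (ejectState μ h θ) u) i).sub
          (hasDerivAt_pi.mp (hU u hu) i)).hasDerivWithinAt)) (fun u hu => by
            rw [← dist_eq_norm]
            refine (dist_le_pi_dist _ _ i).trans ((hK.dist_le_mul _ _).trans ?_)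
            rw [mul_assoc]
            gcongr
            exact hdist u hu)
        (Set.left_mem_Icc.mpr (by norm_num)) hs'
      simpa [h0, abs_of_pos hs.1] using this
    have h0 := key 0 (by rw [hγ0]; change (0 : ℝ) = 0 * _; ring)
    have h1 := key 1 (by rw [hγ0]; change (0 : ℝ) = 0 * _; ring)
    by_contra hcon
    have hz : γ s 0 ^ 2 + γ s 1 ^ 2 = 0 := by
      have : lcR (γ s) ≤ 0 := not_lt.mp hcon
      unfold lcR at this
      have : 0 ≤ γ s 0 ^ 2 + γ s 1 ^ 2 := by positivity
      linarith
    have hz0 : γ s 0 = 0 := by nlinarith [sq_nonneg (γ s 0), sq_nonneg (γ s 1)]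
    have hz1 : γ s 1 = 0 := by nlinarith [sq_nonneg (γ s 0), sq_nonneg (γ s 1)]
    rw [hz0, zero_sub, abs_neg] at h0
    rw [hz1, zero_sub, abs_neg] at h1
    have h2 : unpOrbit ε θ s 0 ^ 2 + unpOrbit ε θ s 1 ^ 2 = s ^ 2 := by
      change (s * cos (θ / 2 - s ^ 3 / 12)) ^ 2 + (s * sin (θ / 2 - s ^ 3 / 12)) ^ 2 = s ^ 2
      linear_combination s ^ 2 * sin_sq_add_cos_sq (θ / 2 - s ^ 3 / 12)
    have h3 : K * C * μ * s ≤ s / 2 := by nlinarith [hs.1]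
    have h4 := sq_le_sq' (by linarith [neg_abs_le (unpOrbit ε θ s 0), abs_nonneg (unpOrbit ε θ s 0)] : -(s / 2) ≤ unpOrbit ε θ s 0)
      (by linarith [le_abs_self (unpOrbit ε θ s 0)])
    have h5 := sq_le_sq' (by linarith [neg_abs_le (unpOrbit ε θ s 1), abs_nonneg (unpOrbit ε θ s 1)] : -(s / 2) ≤ unpOrbit ε θ s 1)
      (by linarith [le_abs_self (unpOrbit ε θ s 1)])
    nlinarith [hs.1]

theorem abs_mul_sub_mul_le {x x' y y' δ A B : ℝ} (hx : |x - x'| ≤ δ) (hx' : |x'| ≤ A)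
    (hy : |y - y'| ≤ δ) (hy' : |y'| ≤ B) : |x * y - x' * y'| ≤ δ * (A + B + δ) := by
  have h : x * y - x' * y' = (x - x') * (y - y') + (x - x') * y' + x' * (y - y') := by ring
  have h0 : 0 ≤ δ := (abs_nonneg _).trans hx
  have h1 : 0 ≤ A := (abs_nonneg _).trans hx'
  rw [h]
  refine (abs_add_three _ _ _).trans ?_
  rw [abs_mul, abs_mul, abs_mul]
  have e1 := mul_le_mul hx hy (abs_nonneg _) h0
  have e2 := mul_le_mul hx hy' (abs_nonneg _) h0
  have e3 := mul_le_mul hx' hy (abs_nonneg _) h1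
  linarith

/-- Polar state of a regularized state, with the polar angle measured near `ω`. -/
noncomputable def polState (ω : ℝ) (Y : Fin 8 → ℝ) : Fin 4 → ℝ :=
  ![√(lcQ1 Y ^ 2 + lcQ2 Y ^ 2),
    (lcQ1 Y * lcP1 Y + lcQ2 Y * lcP2 Y) / √(lcQ1 Y ^ 2 + lcQ2 Y ^ 2),
    ω + arctan ((lcQ2 Y * cos ω - lcQ1 Y * sin ω) / (lcQ1 Y * cos ω + lcQ2 Y * sin ω)),
    lcQ1 Y * lcP2 Y - lcQ2 Y * lcP1 Y]

theorem polState_spec {ω : ℝ} {Y : Fin 8 → ℝ} (hu : 0 < lcQ1 Y * cos ω + lcQ2 Y * sin ω) :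
    polQ1 (polState ω Y) = lcQ1 Y ∧ polQ2 (polState ω Y) = lcQ2 Y ∧
      polP1 (polState ω Y) = lcP1 Y ∧ polP2 (polState ω Y) = lcP2 Y := by
  set u := lcQ1 Y * cos ω + lcQ2 Y * sin ω with hud
  set v := lcQ2 Y * cos ω - lcQ1 Y * sin ω with hvd
  have h1 := sin_sq_add_cos_sq ω
  have hρ : lcQ1 Y ^ 2 + lcQ2 Y ^ 2 = u ^ 2 + v ^ 2 := by
    rw [hud, hvd]
    linear_combination (-(lcQ1 Y ^ 2 + lcQ2 Y ^ 2)) * h1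
  set ρ := √(lcQ1 Y ^ 2 + lcQ2 Y ^ 2) with hρd
  have hρ2 : ρ ^ 2 = lcQ1 Y ^ 2 + lcQ2 Y ^ 2 := sq_sqrt (by positivity)
  have hρ0 : 0 < ρ := sqrt_pos.mpr (by rw [hρ]; positivity)
  have hs : √(1 + (v / u) ^ 2) = ρ / u := by
    rw [sqrt_eq_iff_mul_self_eq (by positivity) (by positivity)]
    field_simp
    rw [hρ2, hρ]
  have hc : cos (ω + arctan (v / u)) = lcQ1 Y / ρ := by
    rw [cos_add, cos_arctan, sin_arctan, hs]
    field_simp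
    rw [hud, hvd]
    linear_combination lcQ1 Y * h1
  have hd : sin (ω + arctan (v / u)) = lcQ2 Y / ρ := by
    rw [sin_add, cos_arctan, sin_arctan, hs]
    field_simp
    rw [hud, hvd]
    linear_combination lcQ2 Y * h1
  refine ⟨?_, ?_, ?_, ?_⟩
  · change ρ * cos (ω + arctan (v / u)) = _
    rw [hc]; field_simp
  · change ρ * sin (ω + arctan (v / u)) = _
    rw [hd]; field_simp
  · change (lcQ1 Y * lcP1 Y + lcQ2 Y * lcP2 Y) / ρ * cos (ω + arctan (v / u)) -
      (lcQ1 Y * lcP2 Y - lcQ2 Y * lcP1 Y) / ρ * sin (ω + arctan (v / u)) = _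
    rw [hc, hd]; field_simp
    rw [hρ2]; ring
  · change (lcQ1 Y * lcP1 Y + lcQ2 Y * lcP2 Y) / ρ * sin (ω + arctan (v / u)) +
      (lcQ1 Y * lcP2 Y - lcQ2 Y * lcP1 Y) / ρ * cos (ω + arctan (v / u)) = _
    rw [hc, hd]; field_simp
    rw [hρ2]; ring

set_option maxHeartbeats 400000 in
/-- Estimates for the polar state at the end of the first leg of an ejection orbit. -/
theorem polState_bounds {ε θ μ : ℝ} {Y : Fin 8 → ℝ} (hμ0 : 0 ≤ μ) (hμ : μ ≤ 1 / 1000)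
    (hY : ∀ i, |Y i - unpOrbit ε θ 3 i| ≤ 1 / 1000) (h5 : Y 5 = μ)
    (hg : Y 0 * Y 3 - Y 1 * Y 2 = μ * Y 4) :
    0 < lcR Y ∧ 0 < lcQ1 Y * cos (θ - 9 / 2) + lcQ2 Y * sin (θ - 9 / 2) ∧
      2 ≤ polState (θ - 9 / 2) Y 0 ∧ 0 < polState (θ - 9 / 2) Y 1 ∧ polState (θ - 9 / 2) Y 1 ≤ 1 ∧
      |polState (θ - 9 / 2) Y 3 - μ * Y 4| ≤ 8 * μ := by
  set c := cos (θ / 2 - 3 ^ 3 / 12) with hc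
  set d := sin (θ / 2 - 3 ^ 3 / 12) with hd
  have hcd : d ^ 2 + c ^ 2 = 1 := sin_sq_add_cos_sq _
  have hω : θ - 9 / 2 = 2 * (θ / 2 - 3 ^ 3 / 12) := by ring
  have hC : cos (θ - 9 / 2) = c ^ 2 - d ^ 2 := by
    rw [hω, cos_two_mul, ← hc]; linear_combination hcd
  have hS : sin (θ - 9 / 2) = 2 * d * c := by rw [hω, sin_two_mul]
  have c1 : |c| ≤ 1 := abs_cos_le_one _
  have d1 : |d| ≤ 1 := abs_sin_le_one _
  have c3 : |3 * c| ≤ 3 := by rw [abs_mul]; norm_num; linarith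
  have d3 : |3 * d| ≤ 3 := by rw [abs_mul]; norm_num; linarith
  have y0 : |Y 0 - 3 * c| ≤ 1 / 1000 := hY 0
  have y1 : |Y 1 - 3 * d| ≤ 1 / 1000 := hY 1
  have y2 : |Y 2 - c| ≤ 1 / 1000 := hY 2
  have y3 : |Y 3 - d| ≤ 1 / 1000 := hY 3
  have m00 := abs_mul_sub_mul_le y0 c3 y0 c3
  have m11 := abs_mul_sub_mul_le y1 d3 y1 d3
  have m01 := abs_mul_sub_mul_le y0 c3 y1 d3
  have m02 := abs_mul_sub_mul_le y0 c3 y2 c1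
  have m13 := abs_mul_sub_mul_le y1 d3 y3 d1
  have m03 := abs_mul_sub_mul_le y0 c3 y3 d1
  have m12 := abs_mul_sub_mul_le y1 d3 y2 c1
  norm_num at m00 m11 m01 m02 m13 m03 m12
  rw [abs_le] at m00 m11 m01 m02 m13 m03 m12
  have hRl : 4.49 ≤ lcR Y := by unfold lcR; linarith only [m00, m11, hcd]
  have hRu : lcR Y ≤ 4.51 := by unfold lcR; linarith only [m00, m11, hcd]
  have hR0 : 0 < lcR Y := by linarith
  set C := cos (θ - 9 / 2) with hCd
  set S := sin (θ - 9 / 2) with hSd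
  have hCS : S ^ 2 + C ^ 2 = 1 := sin_sq_add_cos_sq _
  have f1 : |lcQ1 Y - 9 / 2 * C| ≤ 0.01 := by
    unfold lcQ1 lcX
    rw [h5, hC, abs_le]; constructor <;> linarith only [m00, m11, hμ, hμ0]
  have f2 : |lcQ2 Y - 9 / 2 * S| ≤ 0.01 := by
    unfold lcQ2
    rw [hS, abs_le]; constructor <;> linarith only [m01]
  have hC1 : |C| ≤ 1 := abs_cos_le_one _
  have hS1 : |S| ≤ 1 := abs_sin_le_one _
  have g1 : |(lcQ1 Y - 9 / 2 * C) * C| ≤ 0.01 := by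
    rw [abs_mul]; exact (mul_le_of_le_one_right (abs_nonneg _) hC1).trans f1
  have g2 : |(lcQ2 Y - 9 / 2 * S) * S| ≤ 0.01 := by
    rw [abs_mul]; exact (mul_le_of_le_one_right (abs_nonneg _) hS1).trans f2
  rw [abs_le] at g1 g2
  have hu : 0 < lcQ1 Y * C + lcQ2 Y * S := by linarith only [g1, g2, hCS]
  have hf1 := sq_le_sq' (abs_le.mp f1).1 (abs_le.mp f1).2
  have hf2 := sq_le_sq' (abs_le.mp f2).1 (abs_le.mp f2).2
  have hρsq : lcQ1 Y ^ 2 + lcQ2 Y ^ 2 = 81 / 4 + 9 * ((lcQ1 Y - 9 / 2 * C) * C) +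
      9 * ((lcQ2 Y - 9 / 2 * S) * S) + (lcQ1 Y - 9 / 2 * C) ^ 2 + (lcQ2 Y - 9 / 2 * S) ^ 2 := by
    linear_combination (81 / 4) * hCS
  set ρ := √(lcQ1 Y ^ 2 + lcQ2 Y ^ 2) with hρ
  have hρl : 4.4 ≤ ρ := by
    refine le_sqrt_of_sq_le ?_
    rw [hρsq]
    linarith only [g1, g2, sq_nonneg (lcQ1 Y - 9 / 2 * C), sq_nonneg (lcQ2 Y - 9 / 2 * S)]
  have hρ0 : 0 < ρ := by linarith only [hρl]
  set n1 := Y 0 * Y 2 - Y 1 * Y 3 with hn1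
  set n2 := Y 0 * Y 3 + Y 1 * Y 2 with hn2
  have hn1b : |n1 / lcR Y| ≤ 2 := by
    rw [abs_div, abs_of_pos hR0, div_le_iff₀ hR0, abs_le]
    constructor <;> linarith only [m02, m13, hRl, hcd, sq_nonneg c, sq_nonneg d]
  have hn2b : |n2 / lcR Y| ≤ 2 := by
    rw [abs_div, abs_of_pos hR0, div_le_iff₀ hR0, abs_le]
    constructor <;>
      linarith only [m03, m12, hRl, hcd, sq_nonneg (c - d), sq_nonneg (c + d)]
  have hXb : |lcX Y| ≤ 4.51 := by
    refine abs_le.mpr ⟨?_, ?_⟩ <;> unfold lcX <;> unfold lcR at hRu <;>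
      linarith only [hRu, sq_nonneg (Y 0), sq_nonneg (Y 1)]
  have hQ2b : |lcQ2 Y| ≤ 4.51 := by
    refine abs_le.mpr ⟨?_, ?_⟩ <;> unfold lcQ2 <;> unfold lcR at hRu <;>
      linarith only [hRu, sq_nonneg (Y 0 - Y 1), sq_nonneg (Y 0 + Y 1)]
  have hrad : lcQ1 Y * lcP1 Y + lcQ2 Y * lcP2 Y =
      (Y 0 * Y 2 + Y 1 * Y 3) - μ * (n1 / lcR Y + lcQ2 Y) := by
    rw [lcP1, lcP2, ← hn1, ← hn2, lcQ1, h5]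
    have : lcX Y * n1 + lcQ2 Y * n2 = (Y 0 * Y 2 + Y 1 * Y 3) * lcR Y := by
      unfold lcX lcQ2 lcR; rw [hn1, hn2]; ring
    field_simp
    linear_combination this
  have hang : lcQ1 Y * lcP2 Y - lcQ2 Y * lcP1 Y =
      μ * Y 4 - μ * (lcX Y + n2 / lcR Y - μ) := by
    rw [lcP1, lcP2, ← hn1, ← hn2, lcQ1, h5, ← hg]
    have : lcX Y * n2 - lcQ2 Y * n1 = (Y 0 * Y 3 - Y 1 * Y 2) * lcR Y := by
      unfold lcX lcQ2 lcR; rw [hn1, hn2]; ring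
    field_simp
    linear_combination this
  have k1 : |μ * (n1 / lcR Y + lcQ2 Y)| ≤ 0.1 := by
    rw [abs_mul, abs_of_nonneg hμ0]
    have := abs_add_le (n1 / lcR Y) (lcQ2 Y)
    have := mul_le_mul hμ (this.trans (add_le_add hn1b hQ2b)) (abs_nonneg _) (by norm_num)
    linarith only [this]
  have k2 : |lcX Y + n2 / lcR Y - μ| ≤ 8 := by
    rw [abs_le] at hXb hn2b ⊢
    constructor <;> linarith only [hXb, hn2b, hμ, hμ0]
  rw [abs_le] at k1
  refine ⟨hR0, hu, ?_, ?_, ?_, ?_⟩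
  · change 2 ≤ ρ
    linarith only [hρl]
  · change 0 < (lcQ1 Y * lcP1 Y + lcQ2 Y * lcP2 Y) / ρ
    refine div_pos ?_ hρ0
    rw [hrad]
    linarith only [k1, m02, m13, hcd]
  · change (lcQ1 Y * lcP1 Y + lcQ2 Y * lcP2 Y) / ρ ≤ 1
    rw [div_le_one hρ0, hrad]
    linarith only [k1, m02, m13, hcd, hρl]
  · change |lcQ1 Y * lcP2 Y - lcQ2 Y * lcP1 Y - μ * Y 4| ≤ 8 * μ
    rw [hang, sub_sub_cancel_left, abs_neg, abs_mul, abs_of_nonneg hμ0, mul_comm]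
    exact mul_le_mul_of_nonneg_right k2 hμ0

theorem continuousOn_polState {Y : ℝ → Fin 8 → ℝ} {I : Set ℝ} (hY : Continuous Y)
    (hR : ∀ θ ∈ I, 0 < lcR (Y θ))
    (hu : ∀ θ ∈ I, 0 < lcQ1 (Y θ) * cos (θ - 9 / 2) + lcQ2 (Y θ) * sin (θ - 9 / 2)) :
    ContinuousOn (fun θ => polState (θ - 9 / 2) (Y θ)) I := by
  have hi : ∀ i, ContinuousOn (fun θ => Y θ i) I := fun i =>
    ((continuous_apply i).comp hY).continuousOn
  have hRc : ContinuousOn (fun θ => lcR (Y θ)) I := by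
    unfold lcR
    exact ((hi 0).pow 2 |>.add ((hi 1).pow 2)).div_const 2
  have hQ1 : ContinuousOn (fun θ => lcQ1 (Y θ)) I := by
    unfold lcQ1 lcX
    exact (((hi 0).pow 2 |>.sub ((hi 1).pow 2)).div_const 2).sub (hi 5)
  have hQ2 : ContinuousOn (fun θ => lcQ2 (Y θ)) I := (hi 0).mul (hi 1)
  have hP1 : ContinuousOn (fun θ => lcP1 (Y θ)) I :=
    (((hi 0).mul (hi 2)).sub ((hi 1).mul (hi 3))).div hRc fun θ hθ => (hR θ hθ).ne'
  have hP2 : ContinuousOn (fun θ => lcP2 (Y θ)) I :=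
    ((((hi 0).mul (hi 3)).add ((hi 1).mul (hi 2))).div hRc fun θ hθ => (hR θ hθ).ne').sub (hi 5)
  have hρ : ContinuousOn (fun θ => √(lcQ1 (Y θ) ^ 2 + lcQ2 (Y θ) ^ 2)) I :=
    ((hQ1.pow 2).add (hQ2.pow 2)).sqrt
  have hρ0 : ∀ θ ∈ I, √(lcQ1 (Y θ) ^ 2 + lcQ2 (Y θ) ^ 2) ≠ 0 := fun θ hθ => by
    refine (sqrt_pos.mpr ?_).ne'
    by_contra hcon
    have h1 : lcQ1 (Y θ) = 0 := by nlinarith [sq_nonneg (lcQ1 (Y θ)), sq_nonneg (lcQ2 (Y θ))]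
    have h2 : lcQ2 (Y θ) = 0 := by nlinarith [sq_nonneg (lcQ1 (Y θ)), sq_nonneg (lcQ2 (Y θ))]
    have := hu θ hθ
    rw [h1, h2] at this
    simp at this
  have hω : ContinuousOn (fun θ : ℝ => θ - 9 / 2) I := by fun_prop
  have hcos : ContinuousOn (fun θ : ℝ => cos (θ - 9 / 2)) I := by fun_prop
  have hsin : ContinuousOn (fun θ : ℝ => sin (θ - 9 / 2)) I := by fun_prop
  refine continuousOn_pi.mpr fun i => ?_
  fin_cases i
  · exact hρ
  · exact ((hQ1.mul hP1).add (hQ2.mul hP2)).div hρ hρ0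
  · exact hω.add (continuous_arctan.comp_continuousOn
      (((hQ2.mul hcos).sub (hQ1.mul hsin)).div ((hQ1.mul hcos).add (hQ2.mul hsin))
        fun θ hθ => (hu θ hθ).ne'))
  · exact (hQ1.mul hP2).sub (hQ2.mul hP1)

/-- Integrand of the potential whose derivative in the direction `θ` is the angular momentum. -/
noncomputable def unpPotRate (θ s : ℝ) : ℝ :=
  s ^ 2 / 2 * (√(unpD θ s))⁻¹ - s ^ 4 / 4 * cos (θ - s ^ 3 / 6)

/-- A potential for the final angular momentum of the unperturbed ejection orbits. -/
noncomputable def unpPot (θ : ℝ) : ℝ := ∫ s in (0 : ℝ)..3, unpPotRate θ s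

theorem continuous_unpD : Continuous fun p : ℝ × ℝ => unpD p.1 p.2 := by
  unfold unpD
  fun_prop

theorem continuousOn_unpPotRate {θ : ℝ} (h : ∀ s ∈ Set.Icc (0 : ℝ) 3, 0 < unpD θ s) :
    ContinuousOn (unpPotRate θ) (Set.Icc 0 3) := by
  have hD : Continuous (unpD θ) := continuous_unpD.comp (by fun_prop : Continuous fun s => (θ, s))
  unfold unpPotRate
  refine ContinuousOn.sub (ContinuousOn.mul (by fun_prop) (hD.sqrt.continuousOn.inv₀ fun s hs =>
    (sqrt_pos.mpr (h s hs)).ne')) (by fun_prop)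

theorem hasDerivAt_unpPotRate {ε θ s : ℝ} (hε : 0 < ε) (hD : ε ≤ unpD θ s) :
    HasDerivAt (fun x => unpPotRate x s) (unpRate ε θ s) θ := by
  have hD0 := hε.trans_le hD
  have hs := sqrt_pos.mpr hD0
  have hφ : HasDerivAt (fun x => x - s ^ 3 / 6) 1 θ := (hasDerivAt_id θ).sub_const _
  have hd : HasDerivAt (fun x => unpD x s) (s ^ 2 * sin (θ - s ^ 3 / 6)) θ := by
    refine ((hφ.cos.const_mul (s ^ 2)).const_sub (1 + s ^ 4 / 4)).congr_deriv ?_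
    ring
  refine ((((hd.sqrt hD0.ne').inv hs.ne').const_mul (s ^ 2 / 2)).sub
    (hφ.cos.const_mul (s ^ 4 / 4))).congr_deriv ?_
  rw [unpRate, max_eq_left hD]
  field_simp
  ring

theorem hasDerivAt_unpPot {a b ε θ : ℝ} (hε : 0 < ε)
    (hD : ∀ θ ∈ Set.Icc a b, ∀ s ∈ Set.Icc (0 : ℝ) 4, ε ≤ unpD θ s) (hθ : θ ∈ Set.Ioo a b) :
    HasDerivAt unpPot (unpOrbit ε θ 3 4) θ := by
  have hI : ∀ s, s ∈ Set.uIoc (0 : ℝ) 3 → s ∈ Set.Icc (0 : ℝ) 4 := fun s hs => by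
    rw [Set.uIoc_of_le (by norm_num)] at hs
    exact ⟨hs.1.le, by linarith [hs.2]⟩
  have hD3 : ∀ θ ∈ Set.Icc a b, ∀ s ∈ Set.Icc (0 : ℝ) 3, 0 < unpD θ s := fun θ hθ s hs =>
    hε.trans_le (hD θ hθ s ⟨hs.1, by linarith [hs.2]⟩)
  refine (intervalIntegral.hasDerivAt_integral_of_dominated_loc_of_deriv_le
    (F := unpPotRate) (F' := unpRate ε) (bound := fun _ => 64 * (1 + (√ε)⁻¹ ^ 3))
    (Icc_mem_nhds hθ.1 hθ.2) ?_ ?_ ?_ ?_ ?_ ?_).2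
  · filter_upwards [Icc_mem_nhds hθ.1 hθ.2] with x hx
    rw [Set.uIoc_of_le (by norm_num)]
    exact ((continuousOn_unpPotRate (hD3 x hx)).mono Set.Ioc_subset_Icc_self).aestronglyMeasurable
      measurableSet_Ioc
  · exact (continuousOn_unpPotRate (hD3 θ (Set.Ioo_subset_Icc_self hθ))).intervalIntegrable_of_Icc
      (by norm_num)
  · exact (continuous_unpRate hε θ).aestronglyMeasurable
  · exact Eventually.of_forall fun s hs x _ => abs_unpRate_le hε x (hI s hs)
  · exact intervalIntegrable_const
  · exact Eventually.of_forall fun s hs x hx => hasDerivAt_unpPotRate hε (hD x hx s (hI s hs))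

theorem cos_lt_one_of_mem {x : ℝ} (hx : x ∈ Set.Ioo 0 (2 * π)) : cos x < 1 := by
  have h : x = 2 * (x / 2) := by ring
  have := sin_pos_of_pos_of_lt_pi (x := x / 2) (by linarith [hx.1]) (by linarith [hx.2])
  rw [h, cos_two_mul]
  nlinarith [sin_sq_add_cos_sq (x / 2)]

theorem unpD_eq (θ s : ℝ) :
    unpD θ s = (s ^ 2 / 2 - 1) ^ 2 + s ^ 2 * (1 - cos (θ - s ^ 3 / 6)) := by
  unfold unpD
  ring

/-- The unperturbed orbit meets the orbit of the second primary at time `√2`, when its direction has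
turned by `√2 / 3`; it meets the second primary itself only if it starts in this direction. -/
theorem unpD_pos {θ s : ℝ} (hθ : θ ∈ Set.Ioo (√2 / 3) (√2 / 3 + 2 * π)) (hs : 0 ≤ s) :
    0 < unpD θ s := by
  rw [unpD_eq]
  have hc : 0 ≤ s ^ 2 * (1 - cos (θ - s ^ 3 / 6)) :=
    mul_nonneg (sq_nonneg _) (sub_nonneg.mpr (cos_le_one _))
  by_cases h : s ^ 2 = 2
  · have h1 : s = √2 := by rw [← h, sqrt_sq hs]
    have h2 : θ - s ^ 3 / 6 = θ - √2 / 3 := by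
      rw [pow_succ, h, h1]; ring
    rw [h2, h]
    have := cos_lt_one_of_mem (x := θ - √2 / 3) ⟨by linarith [hθ.1], by linarith [hθ.2]⟩
    norm_num
    exact this
  · have : s ^ 2 / 2 - 1 ≠ 0 := fun h' => h (by linarith)
    positivity

theorem exists_lower_unpD {a b : ℝ} (ha : √2 / 3 < a) (hb : b < √2 / 3 + 2 * π) :
    ∃ ε, 0 < ε ∧ ∀ θ ∈ Set.Icc a b, ∀ s ∈ Set.Icc (0 : ℝ) 4, ε ≤ unpD θ s := by
  obtain ⟨ε, hε, h⟩ := (isCompact_Icc.prod isCompact_Icc :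
    IsCompact (Set.Icc a b ×ˢ Set.Icc (0 : ℝ) 4)).exists_forall_le' continuous_unpD.continuousOn
    (a := 0) fun p hp => unpD_pos ⟨ha.trans_le hp.1.1, hp.1.2.trans_lt hb⟩ hp.2.1
  exact ⟨ε, hε, fun θ hθ s hs => h (θ, s) ⟨hθ, hs⟩⟩

theorem unpD_periodic (θ s : ℝ) : unpD (θ + 2 * π) s = unpD θ s := by
  rw [unpD, unpD, add_sub_right_comm θ, cos_add_two_pi]

theorem unpPot_periodic (θ : ℝ) : unpPot (θ + 2 * π) = unpPot θ := by
  unfold unpPot unpPotRate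
  simp only [unpD_periodic, add_sub_right_comm, cos_add_two_pi]

theorem unpD_le {δ s : ℝ} (h1 : √2 ≤ s) (h2 : s ≤ 2) :
    √(unpD (√2 / 3 + δ) s) ≤ 4 * (s - √2 + |δ|) := by
  have hq : √2 ^ 2 = 2 := sq_sqrt (by norm_num)
  have hq0 : 0 ≤ √2 := sqrt_nonneg 2
  have hq2 : √2 ≤ 2 := h1.trans h2
  set σ := s - √2 with hσ
  have hσ0 : 0 ≤ σ := sub_nonneg.mpr h1
  have hs : s = √2 + σ := by ring
  have hδ := abs_nonneg δ
  have hs0 : 0 ≤ s := hq0.trans h1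
  refine sqrt_le_iff.mpr ⟨by positivity, ?_⟩
  rw [unpD_eq]
  have hr : s ^ 2 / 2 - 1 = σ * ((s + √2) / 2) := by
    rw [hσ]; linear_combination (1 / 2 : ℝ) * hq
  have hr' : (s ^ 2 / 2 - 1) ^ 2 ≤ (2 * σ) ^ 2 := by
    rw [hr]
    refine pow_le_pow_left₀ (by positivity) ?_ 2
    nlinarith
  have hφ : |√2 / 3 + δ - s ^ 3 / 6| ≤ |δ| + 2 * σ := by
    have e : √2 / 3 + δ - s ^ 3 / 6 = δ - σ * ((s ^ 2 + √2 * s + √2 ^ 2) / 6) := by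
      rw [hσ]; linear_combination (-√2 / 6) * hq
    rw [e]
    refine (abs_sub _ _).trans (add_le_add le_rfl ?_)
    rw [abs_of_nonneg (by positivity), mul_comm]
    refine mul_le_mul_of_nonneg_right ?_ hσ0
    nlinarith
  have hφ2 : (√2 / 3 + δ - s ^ 3 / 6) ^ 2 ≤ (|δ| + 2 * σ) ^ 2 := by
    rw [← sq_abs]
    exact pow_le_pow_left₀ (abs_nonneg _) hφ 2
  have hc := one_sub_sq_div_two_le_cos (x := √2 / 3 + δ - s ^ 3 / 6)
  have hs2 : s ^ 2 ≤ 4 := by nlinarith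
  have hx : s ^ 2 * (1 - cos (√2 / 3 + δ - s ^ 3 / 6)) ≤ 4 * ((|δ| + 2 * σ) ^ 2 / 2) :=
    mul_le_mul hs2 (by linarith) (sub_nonneg.mpr (cos_le_one _)) (by norm_num)
  nlinarith [mul_nonneg hδ hσ0, sq_nonneg |δ|]

theorem unpPot_lower {δ : ℝ} (hδ : δ ≠ 0) (hD : ∀ s ∈ Set.Icc (0 : ℝ) 3, 0 < unpD (√2 / 3 + δ) s) :
    log (1 / (2 * |δ|)) / 4 - 61 ≤ unpPot (√2 / 3 + δ) := by
  have hδ' : 0 < |δ| := abs_pos.mpr hδ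
  have hq : √2 ^ 2 = 2 := sq_sqrt (by norm_num)
  have hq0 : 0 ≤ √2 := sqrt_nonneg 2
  have hq2 : √2 ≤ 3 / 2 := by nlinarith
  have hc := continuousOn_unpPotRate hD
  have hi : ∀ a b, 0 ≤ a → a ≤ b → b ≤ 3 →
      IntervalIntegrable (unpPotRate (√2 / 3 + δ)) volume a b := fun a b h1 h2 h3 =>
    (hc.mono (Set.Icc_subset_Icc h1 h3)).intervalIntegrable_of_Icc h2
  have hl : ∀ s ∈ Set.Icc (0 : ℝ) 3,
      s ^ 2 / 2 * (√(unpD (√2 / 3 + δ) s))⁻¹ - 81 / 4 ≤ unpPotRate (√2 / 3 + δ) s := fun s hs => by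
    have h1 := pow_le_pow_left₀ hs.1 hs.2 4
    have h2 : s ^ 4 / 4 * cos (√2 / 3 + δ - s ^ 3 / 6) ≤ s ^ 4 / 4 :=
      mul_le_of_le_one_right (by positivity) (cos_le_one _)
    unfold unpPotRate
    linarith
  have hout : ∀ a b, 0 ≤ a → a ≤ b → b ≤ 3 →
      (b - a) * (-81 / 4) ≤ ∫ s in a..b, unpPotRate (√2 / 3 + δ) s := fun a b h1 h2 h3 => by
    rw [← smul_eq_mul, ← intervalIntegral.integral_const]
    refine intervalIntegral.integral_mono_on h2 intervalIntegrable_const (hi a b h1 h2 h3)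
      fun s hs => le_trans ?_ (hl s ⟨h1.trans hs.1, hs.2.trans h3⟩)
    have : 0 ≤ s ^ 2 / 2 * (√(unpD (√2 / 3 + δ) s))⁻¹ := by positivity
    linarith
  have hci : ContinuousOn (fun s : ℝ => (s - (√2 - |δ|))⁻¹) (Set.Icc (√2) 2) :=
    ContinuousOn.inv₀ (by fun_prop) fun s hs => by
      have := hs.1
      have : 0 < s - (√2 - |δ|) := by linarith
      exact this.ne'
  have hmid : log (1 / (2 * |δ|)) / 4 + (2 - √2) * (-81 / 4) ≤
      ∫ s in (√2)..2, unpPotRate (√2 / 3 + δ) s := by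
    have e : ∫ s in (√2)..2, ((s - (√2 - |δ|))⁻¹ / 4 + -81 / 4) =
        log ((2 - √2 + |δ|) / |δ|) / 4 + (2 - √2) * (-81 / 4) := by
      rw [intervalIntegral.integral_add, intervalIntegral.integral_div,
        intervalIntegral.integral_comp_sub_right (fun x => x⁻¹), integral_inv_of_pos,
        intervalIntegral.integral_const, smul_eq_mul]
      · congr 3
        ring_nf
      · linarith
      · linarith
      · exact (hci.div_const 4).intervalIntegrable_of_Icc (by linarith)
      · exact intervalIntegrable_const
    have h1 : log (1 / (2 * |δ|)) ≤ log ((2 - √2 + |δ|) / |δ|) := by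
      refine log_le_log (by positivity) ?_
      rw [div_le_div_iff₀ (by positivity) hδ']
      nlinarith
    refine (add_le_add (div_le_div_of_nonneg_right h1 (by norm_num)) le_rfl).trans (e ▸ ?_)
    refine intervalIntegral.integral_mono_on (by linarith)
      (((hci.div_const 4).add continuousOn_const).intervalIntegrable_of_Icc (by linarith))
      (hi _ _ hq0 (by linarith) (by norm_num)) fun s hs => le_trans ?_
        (hl s ⟨hq0.trans hs.1, by linarith [hs.2]⟩)
    have h2 := inv_anti₀ (sqrt_pos.mpr (hD s ⟨hq0.trans hs.1, by linarith [hs.2]⟩))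
      (unpD_le (δ := δ) hs.1 hs.2)
    have h3 : (s - (√2 - |δ|))⁻¹ / 4 = (4 * (s - √2 + |δ|))⁻¹ := by
      rw [mul_inv, sub_sub_eq_add_sub, add_sub_right_comm]; ring
    have h4 : 1 ≤ s ^ 2 / 2 := by
      have := pow_le_pow_left₀ hq0 hs.1 2
      linarith
    have h5 := mul_le_mul h4 le_rfl (inv_nonneg.mpr (sqrt_nonneg (unpD (√2 / 3 + δ) s)))
      (by linarith)
    rw [h3]
    linarith
  have hs1 := intervalIntegral.integral_add_adjacent_intervals
    (hi 0 (√2) le_rfl hq0 (by linarith)) (hi (√2) 2 hq0 (by linarith) (by norm_num))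
  have hs2 := intervalIntegral.integral_add_adjacent_intervals
    (hi 0 2 le_rfl (by norm_num) (by norm_num)) (hi 2 3 (by norm_num) (by norm_num) le_rfl)
  have o1 := hout 0 (√2) le_rfl hq0 (by linarith)
  have o2 := hout 2 3 (by norm_num) (by norm_num) le_rfl
  unfold unpPot
  linarith

/-- Near the direction of collision with the second primary, the angular momentum of the unperturbed
orbits takes arbitrarily large values of both signs. -/
theorem exists_angMom_range (M : ℝ) : ∃ a b ε : ℝ, a ≤ b ∧ 0 < ε ∧
    (∀ θ ∈ Set.Icc a b, ∀ s ∈ Set.Icc (0 : ℝ) 4, 2 * ε ≤ unpD θ s) ∧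
    unpOrbit ε a 3 4 ≤ -M ∧ M ≤ unpOrbit ε b 3 4 := by
  have hπ := pi_gt_three
  have hq0 : 0 ≤ √2 := sqrt_nonneg 2
  set c := √2 / 3 with hc
  have hder : ∀ θ ∈ Set.Ioo c (c + 2 * π), ∃ ε₀, 0 < ε₀ ∧ ∀ ε, 0 < ε → ε ≤ ε₀ →
      HasDerivAt unpPot (unpOrbit ε θ 3 4) θ := fun θ hθ => by
    obtain ⟨ε₀, h0, h⟩ := exists_lower_unpD (a := (c + θ) / 2) (b := (θ + (c + 2 * π)) / 2)
      (by rw [← hc]; linarith [hθ.1]) (by rw [← hc]; linarith [hθ.2])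
    exact ⟨ε₀, h0, fun ε hε hle => hasDerivAt_unpPot hε (fun θ hθ s hs => hle.trans (h θ hθ s hs))
      ⟨by linarith [hθ.1], by linarith [hθ.2]⟩⟩
  have hd : ∀ θ ∈ Set.Ioo c (c + 2 * π), HasDerivAt unpPot (deriv unpPot θ) θ := fun θ hθ => by
    obtain ⟨ε₀, h0, h⟩ := hder θ hθ
    exact (h ε₀ h0 le_rfl).differentiableAt.hasDerivAt
  set m := max 0 (max (unpPot (c + 1)) (unpPot (c - 1 + 2 * π)) + |M| + 61) with hm
  set δ := exp (-(4 * m)) / 2 with hδ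
  have hm0 : 0 ≤ m := le_max_left _ _
  have hm1 := le_max_right 0 (max (unpPot (c + 1)) (unpPot (c - 1 + 2 * π)) + |M| + 61)
  have hmA := le_max_left (unpPot (c + 1)) (unpPot (c - 1 + 2 * π))
  have hmB := le_max_right (unpPot (c + 1)) (unpPot (c - 1 + 2 * π))
  have hδ0 : 0 < δ := by positivity
  have hδ1 : δ ≤ 1 / 2 := by
    have : exp (-(4 * m)) ≤ 1 := exp_le_one_iff.mpr (by linarith)
    rw [hδ]; linarith
  have hlog : log (1 / (2 * δ)) = 4 * m := by
    rw [hδ, mul_div_cancel₀ _ two_ne_zero, one_div, ← exp_neg, log_exp, neg_neg]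
  have hM := le_abs_self M
  have hM0 := abs_nonneg M
  have hR : m - 61 ≤ unpPot (c + δ) := by
    have := unpPot_lower hδ0.ne' fun s hs => unpD_pos ⟨by linarith, by linarith⟩ hs.1
    rw [abs_of_pos hδ0, hlog] at this
    linarith
  have hL : m - 61 ≤ unpPot (c - δ + 2 * π) := by
    have := unpPot_lower (neg_ne_zero.mpr hδ0.ne') fun s hs => by
      rw [← unpD_periodic]
      exact unpD_pos ⟨by linarith, by linarith⟩ hs.1
    rw [abs_neg, abs_of_pos hδ0, hlog] at this
    rw [unpPot_periodic, sub_eq_add_neg c, hc]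
    linarith
  have mvt : ∀ x y, c < x → x < y → y < c + 2 * π →
      ∃ ξ ∈ Set.Ioo x y, deriv unpPot ξ * (y - x) = unpPot y - unpPot x := fun x y h1 h2 h3 => by
    have hxy : ∀ ξ ∈ Set.Icc x y, HasDerivAt unpPot (deriv unpPot ξ) ξ := fun ξ hξ =>
      hd ξ ⟨h1.trans_le hξ.1, hξ.2.trans_lt h3⟩
    obtain ⟨ξ, hξ, e⟩ := exists_hasDerivAt_eq_slope unpPot (deriv unpPot) h2
      (fun ξ hξ => (hxy ξ hξ).continuousAt.continuousWithinAt)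
      fun ξ hξ => hxy ξ (Set.Ioo_subset_Icc_self hξ)
    exact ⟨ξ, hξ, by rw [e, div_mul_cancel₀ _ (sub_pos.mpr h2).ne']⟩
  obtain ⟨a, ha, ea⟩ := mvt (c + δ) (c + 1) (by linarith) (by linarith) (by linarith)
  obtain ⟨b, hb, eb⟩ := mvt (c - 1 + 2 * π) (c - δ + 2 * π) (by linarith) (by linarith)
    (by linarith)
  have ha' : a ∈ Set.Ioo c (c + 2 * π) := ⟨by linarith [ha.1], by linarith [ha.2]⟩
  have hb' : b ∈ Set.Ioo c (c + 2 * π) := ⟨by linarith [hb.1], by linarith [hb.2]⟩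
  obtain ⟨ε₁, h1, H1⟩ := hder a ha'
  obtain ⟨ε₂, h2, H2⟩ := hder b hb'
  obtain ⟨ε₃, h3, H3⟩ := exists_lower_unpD ha'.1 hb'.2
  refine ⟨a, b, min ε₁ (min ε₂ (ε₃ / 2)), by linarith [ha.2, hb.1], by positivity,
    fun θ hθ s hs => le_trans ?_ (H3 θ hθ s hs), ?_, ?_⟩
  · have := (min_le_right ε₁ _).trans (min_le_right ε₂ (ε₃ / 2))
    linarith
  · rw [(H1 _ (by positivity) (min_le_left _ _)).unique (hd a ha')]
    by_contra! hcon
    nlinarith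
  · rw [(H2 _ (by positivity) ((min_le_right _ _).trans (min_le_left _ _))).unique (hd b hb')]
    by_contra! hcon
    nlinarith

theorem IsPCRTBPSol.comp_sub_const {μ : ℝ} {I : Set ℝ} {q1 q2 p1 p2 : ℝ → ℝ}
    (h : IsPCRTBPSol μ I q1 q2 p1 p2) (c : ℝ) :
    IsPCRTBPSol μ ((fun t => t - c) ⁻¹' I) (fun t => q1 (t - c)) (fun t => q2 (t - c))
      (fun t => p1 (t - c)) fun t => p2 (t - c) := fun t ht => by
  obtain ⟨hne, h1, h2, h3, h4⟩ := h (t - c) ht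
  exact ⟨hne, h1.comp_sub_const t c, h2.comp_sub_const t c, h3.comp_sub_const t c,
    h4.comp_sub_const t c⟩

/-- Ejection orbits that meet the symmetry axis perpendicularly far away. -/
theorem exists_perpendicular_ejection : ∃ μ₀ : ℝ, 0 < μ₀ ∧ ∀ μ h : ℝ, 0 < μ → μ < μ₀ → |h| < μ →
    ∀ B : ℝ, ∃ T, 0 < T ∧ ∃ q1 q2 p1 p2 : ℝ → ℝ, IsPCRTBPSol μ (Set.Ioc 0 T) q1 q2 p1 p2 ∧
      Ham μ (q1 T) (q2 T) (p1 T) (p2 T) = h ∧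
      Tendsto (fun t => (q1 t, q2 t)) (𝓝[>] 0) (𝓝 (-μ, 0)) ∧
      q2 T = 0 ∧ p1 T = 0 ∧ B < nrm2 (q1 T) (q2 T) := by
  obtain ⟨a, b, ε, hab, hε, hD, ha, hb⟩ := exists_angMom_range 50
  obtain ⟨μ₁, C, hμ₁, hC, hfam⟩ := exists_ejection_family hε hD
  set A := 256 * (1 + (√ε)⁻¹ ^ 3) with hA
  have hA0 : 0 < A := by positivity
  refine ⟨min μ₁ (min (1 / 1000) (min (1 / (1000 * (C + 1))) (1 / (4 * (A + 9))))), by positivity,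
    fun μ h hμ0 hμ hh B => ?_⟩
  simp only [lt_min_iff] at hμ
  obtain ⟨m1, m2, m3, m4⟩ := hμ
  rw [lt_div_iff₀ (by positivity)] at m3 m4
  obtain ⟨Γ, hΓc, hΓ⟩ := hfam μ h hμ0 m1 hh
  have h3 : (3 : ℝ) ∈ Set.Icc (0 : ℝ) 4 := ⟨by norm_num, by norm_num⟩
  have hCμ : C * μ ≤ 1 / 1000 := by nlinarith
  have hclose : ∀ θ ∈ Set.Icc a b, ∀ i, |Γ θ 3 i - unpOrbit ε θ 3 i| ≤ 1 / 1000 := fun θ hθ i =>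
    ((hΓ θ hθ).2.2.2 i).trans hCμ
  have hbd := fun θ (hθ : θ ∈ Set.Icc a b) =>
    have hI := (hΓ θ hθ).1.integrals (hΓ θ hθ).2.1 h3
    polState_bounds hμ0.le m2.le (hclose θ hθ) hI.1 hI.2.2.2
  have hham := fun θ (hθ : θ ∈ Set.Icc a b) =>
    (hΓ θ hθ).1.ham_eq (hΓ θ hθ).2.1 h3 (hbd θ hθ).1
  have hspec := fun θ (hθ : θ ∈ Set.Icc a b) => polState_spec (hbd θ hθ).2.1
  have hG : ∀ θ ∈ Set.Icc a b, |polState (θ - 9 / 2) (Γ θ 3) 3| ≤ 1 / 4 := fun θ hθ => by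
    have e1 := abs_le.mp (hbd θ hθ).2.2.2.2.2
    have e2 := abs_le.mp (hclose θ hθ 4)
    have e3 := abs_le.mp (abs_unpOrbit_le hε θ h3 4)
    rw [abs_le]
    constructor <;> nlinarith
  have haI : a ∈ Set.Icc a b := ⟨le_rfl, hab⟩
  have hbI : b ∈ Set.Icc a b := ⟨hab, le_rfl⟩
  obtain ⟨θ, hθ, T, hT, q1', q2', p1', p2', hfar, f1, f2, f3, f4, fq, fp, fB⟩ :=
    exists_far_arc hμ0 (by linarith) hh hab (Y := fun θ => polState (θ - 9 / 2) (Γ θ 3))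
      (continuousOn_polState hΓc (fun θ hθ => (hbd θ hθ).1) fun θ hθ => (hbd θ hθ).2.1)
      (fun θ hθ => (hbd θ hθ).2.2.1) (fun θ hθ => (hbd θ hθ).2.2.2.1)
      (fun θ hθ => (hbd θ hθ).2.2.2.2.1) hG
      (fun θ hθ => by
        obtain ⟨e1, e2, e3, e4⟩ := hspec θ hθ
        rw [e1, e2, e3, e4, hham θ hθ])
      (by
        have e1 := abs_le.mp (hbd a haI).2.2.2.2.2
        have e2 := abs_le.mp (hclose a haI 4)
        nlinarith)
      (by
        have e1 := abs_le.mp (hbd b hbI).2.2.2.2.2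
        have e2 := abs_le.mp (hclose b hbI 4)
        nlinarith) B
  obtain ⟨t₁, ht₁, q1, q2, p1, p2, hnear, hlim, n1, n2, n3, n4⟩ :=
    (hΓ θ hθ).1.exists_solution (hΓ θ hθ).2.1 (hΓ θ hθ).2.2.1
      (s₁ := 3) ⟨by norm_num, by norm_num⟩
  obtain ⟨e1, e2, e3, e4⟩ := hspec θ hθ
  have hglue := hnear.glue (hfar.comp_sub_const t₁) (t₀ := t₁) ⟨ht₁, le_rfl⟩
    (by simpa using hT.le) (by rw [sub_self, n1, f1, e1]) (by rw [sub_self, n2, f2, e2])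
    (by rw [sub_self, n3, f3, e3]) (by rw [sub_self, n4, f4, e4])
  have hsol := fun t (ht : t ∈ Set.Ioc 0 (t₁ + T)) => hglue t (by
    rcases le_total t t₁ with h | h
    · exact Or.inl ⟨⟨ht.1, h⟩, h⟩
    · exact Or.inr ⟨⟨by linarith, by linarith [ht.2]⟩, h⟩)
  have hn : ¬ t₁ + T ≤ t₁ := by linarith
  have hham' := IsPCRTBPSol.ham_eq (convex_Ioc _ _) hsol
    (s := t₁ + T) (t := t₁) ⟨by linarith, le_rfl⟩ ⟨ht₁, by linarith⟩
  refine ⟨t₁ + T, by linarith, _, _, _, _, hsol, ?_, ?_, ?_, ?_, ?_⟩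
  · rw [hham']
    simp only [le_refl, if_true, n1, n2, n3, n4, hham θ hθ]
  · refine hlim.congr' ?_
    filter_upwards [mem_nhdsWithin_of_mem_nhds (Iio_mem_nhds ht₁)] with t ht
    have ht' : t ≤ t₁ := le_of_lt (Set.mem_Iio.mp ht)
    simp only [if_pos ht']
  · simpa only [if_neg hn, add_sub_cancel_left] using fq
  · simpa only [if_neg hn, add_sub_cancel_left] using fp
  · simpa only [if_neg hn, add_sub_cancel_left] using fB

/-- There are `η > 0` and `μ₀ > 0` such that for all `μ ∈ (0,μ₀)` and all energies
`h ∈ (-ημ, ημ)` there is a sequence of ejection–collision orbits with the first primary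
at energy `h` whose excursions are unbounded as `k → ∞`. -/
theorem unboundedly_large_ejection_collision_orbits :
    ∃ η : ℝ, 0 < η ∧ ∃ μ₀ : ℝ, 0 < μ₀ ∧
      ∀ μ ∈ Set.Ioo (0 : ℝ) μ₀, ∀ h ∈ Set.Ioo (-(η * μ)) (η * μ),
        ∃ (a b : ℕ → ℝ) (q1 q2 p1 p2 : ℕ → ℝ → ℝ),
          (∀ k : ℕ,
            a k < b k ∧
            IsPCRTBPSol μ (Set.Ioo (a k) (b k)) (q1 k) (q2 k) (p1 k) (p2 k) ∧
            (∀ t ∈ Set.Ioo (a k) (b k),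
              Ham μ (q1 k t) (q2 k t) (p1 k t) (p2 k t) = h) ∧
            Tendsto (fun t => (q1 k t, q2 k t))
              (nhdsWithin (a k) (Set.Ioi (a k))) (𝓝 (-μ, 0)) ∧
            Tendsto (fun t => (q1 k t, q2 k t))
              (nhdsWithin (b k) (Set.Iio (b k))) (𝓝 (-μ, 0))) ∧
          (∀ M : ℝ, ∃ᶠ k in atTop, ∃ t ∈ Set.Ioo (a k) (b k),
            M < nrm2 (q1 k t) (q2 k t)) := by
  obtain ⟨μ₀, hμ₀, H⟩ := exists_perpendicular_ejection
  refine ⟨1, one_pos, μ₀, hμ₀, fun μ hμ h hh => ?_⟩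
  rw [one_mul] at hh
  have key : ∀ k : ℕ, ∃ (b : ℝ) (Q1 Q2 P1 P2 : ℝ → ℝ), 0 < b ∧
      IsPCRTBPSol μ (Set.Ioo 0 b) Q1 Q2 P1 P2 ∧
      (∀ t ∈ Set.Ioo 0 b, Ham μ (Q1 t) (Q2 t) (P1 t) (P2 t) = h) ∧
      Tendsto (fun t => (Q1 t, Q2 t)) (𝓝[>] 0) (𝓝 (-μ, 0)) ∧
      Tendsto (fun t => (Q1 t, Q2 t)) (𝓝[<] b) (𝓝 (-μ, 0)) ∧
      ∃ t ∈ Set.Ioo 0 b, (k : ℝ) < nrm2 (Q1 t) (Q2 t) := fun k => by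
    obtain ⟨T, hT, q1, q2, p1, p2, hsol, hham, hlim, hq, hp, hB⟩ :=
      H μ h hμ.1 hμ.2 (abs_lt.mpr hh) k
    obtain ⟨b, Q1, Q2, P1, P2, hb, hs, hH, l1, l2, t, ht, t1, t2⟩ :=
      exists_ejection_collision_of_perpendicular hT hsol hham hlim hq hp
    exact ⟨b, Q1, Q2, P1, P2, hb, hs, hH, l1, l2, t, ht, by rwa [t1, t2]⟩
  choose b Q1 Q2 P1 P2 hb hs hH l1 l2 hB using key
  refine ⟨fun _ => 0, b, Q1, Q2, P1, P2, fun k => ⟨hb k, hs k, hH k, l1 k, l2 k⟩, fun M => ?_⟩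
  obtain ⟨N, hN⟩ := exists_nat_ge M
  refine Eventually.frequently ?_
  filter_upwards [eventually_ge_atTop N] with k hk
  obtain ⟨t, ht, hlt⟩ := hB k
  exact ⟨t, ht, (hN.trans (Nat.cast_le.mpr hk)).trans_lt hlt⟩
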